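/- arXiv:1401.5927 — 7 statements merged into one kernel-verified Lean document; each statement's English description precedes it below -/
import Mathlib

section
/- Let T be a cyclic bounded linear operator with dense range on a complex Hilbert space H, and let N be a cyclic nilpotent operator on ℂⁿ for some n ∈ ℕ (i.e., a Jordan block with eigenvalue 0). Then the orthogonal direct sum T ⊕ N acting on H ⊕ ℂⁿ is cyclic; in fact, if f is a cyclic vector for T and e is a cyclic vector for N, then f ⊕ e is a cyclic vector for T ⊕ N. -/
/-- `f` is a cyclic vector for the bounded linear operator `T`: the closed linear span of the
orbit `{Tⁿ f : n ∈ ℤ₊}` is the whole space. -/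
def IsCyclicVector {H : Type*} [NormedAddCommGroup H] [NormedSpace ℂ H]
    (T : H →L[ℂ] H) (f : H) : Prop :=
  (Submodule.span ℂ (Set.range fun n : ℕ => (T ^ n) f)).topologicalClosure = ⊤

/-- A continuous linear map sending the orbit of a cyclic vector into a closed subspace has its
whole range in that subspace. -/
theorem IsCyclicVector.map_mem {E F : Type*} [NormedAddCommGroup E] [NormedSpace ℂ E]
    [NormedAddCommGroup F] [NormedSpace ℂ F] {T : E →L[ℂ] E} {f : E} (hf : IsCyclicVector T f)
    (L : E →L[ℂ] F) {M : Submodule ℂ F} (hM : IsClosed (M : Set F))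
    (h : ∀ k : ℕ, L ((T ^ k) f) ∈ M) (x : E) : L x ∈ M := by
  have hle : (Submodule.span ℂ (Set.range fun k : ℕ => (T ^ k) f)).topologicalClosure ≤
      M.comap L.toLinearMap := by
    refine Submodule.topologicalClosure_minimal _ ?_ (hM.preimage L.continuous)
    rw [Submodule.span_le]
    rintro _ ⟨k, rfl⟩
    exact h k
  rw [hf] at hle
  exact hle Submodule.mem_top

theorem ContinuousLinearMap.denseRange_pow {E : Type*} [NormedAddCommGroup E] [NormedSpace ℂ E]
    {T : E →L[ℂ] E} (hT : DenseRange T) (n : ℕ) : DenseRange (T ^ n) := by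
  induction n with
  | zero => exact Function.surjective_id.denseRange
  | succ n ih =>
    rw [pow_succ]
    exact ih.comp hT (T ^ n).continuous

theorem ContinuousLinearMap.prodMap_pow_apply {E F : Type*} [NormedAddCommGroup E]
    [NormedSpace ℂ E] [NormedAddCommGroup F] [NormedSpace ℂ F] (T : E →L[ℂ] E) (N : F →L[ℂ] F)
    (k : ℕ) (x : E) (y : F) : ((T.prodMap N) ^ k) (x, y) = ((T ^ k) x, (N ^ k) y) := by
  induction k with
  | zero => rfl
  | succ k ih => simp only [pow_succ', mul_apply_eq_comp, ih]; rfl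

/-- Cyclic vectors are preserved by conjugation with a continuous linear equivalence. -/
theorem IsCyclicVector.conj {E F : Type*} [NormedAddCommGroup E] [NormedSpace ℂ E]
    [NormedAddCommGroup F] [NormedSpace ℂ F] {T : E →L[ℂ] E} {f : E} (hf : IsCyclicVector T f)
    (φ : F ≃L[ℂ] E) :
    IsCyclicVector (φ.symm.toContinuousLinearMap.comp (T.comp φ.toContinuousLinearMap))
      (φ.symm f) := by
  have hpow (k : ℕ) : ((φ.symm.toContinuousLinearMap.comp
      (T.comp φ.toContinuousLinearMap)) ^ k) (φ.symm f) = φ.symm ((T ^ k) f) := by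
    induction k with
    | zero => rfl
    | succ k ih => simp [pow_succ', ih]
  refine Submodule.eq_top_iff'.2 fun y => ?_
  rw [← φ.symm_apply_apply y]
  refine hf.map_mem φ.symm.toContinuousLinearMap (Submodule.isClosed_topologicalClosure _)
    (fun k => Submodule.le_topologicalClosure _ ?_) _
  exact Submodule.subset_span ⟨k, hpow k⟩

/-- If `T` has dense range and `N` is nilpotent, a pair of cyclic vectors is cyclic for the
product operator. -/
theorem IsCyclicVector.prodMap {E F : Type*} [NormedAddCommGroup E] [NormedSpace ℂ E]
    [NormedAddCommGroup F] [NormedSpace ℂ F] {T : E →L[ℂ] E} {N : F →L[ℂ] F} {f : E} {e : F}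
    (hf : IsCyclicVector T f) (he : IsCyclicVector N e) (hT : DenseRange T)
    (hN : IsNilpotent N) : IsCyclicVector (T.prodMap N) (f, e) := by
  obtain ⟨n, hn⟩ := hN
  unfold IsCyclicVector
  set M := (Submodule.span ℂ
    (Set.range fun k : ℕ => ((T.prodMap N) ^ k) (f, e))).topologicalClosure
  have hM : IsClosed (M : Set (E × F)) := Submodule.isClosed_topologicalClosure _
  have horbit (k : ℕ) : ((T ^ k) f, (N ^ k) e) ∈ M := by
    rw [← ContinuousLinearMap.prodMap_pow_apply]
    exact Submodule.le_topologicalClosure _ (Submodule.subset_span ⟨k, rfl⟩)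
  have hrange (x : E) : ((T ^ n) x, (0 : F)) ∈ M := by
    refine hf.map_mem ((ContinuousLinearMap.inl ℂ E F).comp (T ^ n)) hM (fun k => ?_) x
    simpa [pow_add, hn] using horbit (n + k)
  have hleft (x : E) : (x, (0 : F)) ∈ M :=
    (ContinuousLinearMap.denseRange_pow hT n).induction_on x
      (hM.preimage (ContinuousLinearMap.inl ℂ E F).continuous) hrange
  have hright (y : F) : ((0 : E), y) ∈ M := by
    refine he.map_mem (ContinuousLinearMap.inr ℂ E F) hM (fun k => ?_) y
    simpa using M.sub_mem (horbit k) (hleft ((T ^ k) f))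
  refine Submodule.eq_top_iff'.2 fun ⟨x, y⟩ => ?_
  simpa using M.add_mem (hleft x) (hright y)

/-- Let `T` be a cyclic bounded linear operator with dense range on a complex Hilbert space `H`,
and let `N` be a cyclic nilpotent operator on `ℂⁿ`.  Then the orthogonal direct sum `T ⊕ N`
(acting on the Hilbert space `H ⊕ ℂⁿ`, modelled as `WithLp 2 (H × ℂⁿ)`) is cyclic; in fact if
`f` is a cyclic vector for `T` and `e` is a cyclic vector for `N`, then `f ⊕ e` is a cyclic
vector for `T ⊕ N`. -/
theorem stmt_1 {H : Type*} [NormedAddCommGroup H] [InnerProductSpace ℂ H] [CompleteSpace H]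
    (T : H →L[ℂ] H) (hTrange : DenseRange T)
    (n : ℕ)
    (N : EuclideanSpace ℂ (Fin n) →L[ℂ] EuclideanSpace ℂ (Fin n))
    (hN : N ^ n = 0)
    (f : H) (hf : IsCyclicVector T f)
    (e : EuclideanSpace ℂ (Fin n)) (he : IsCyclicVector N e) :
    IsCyclicVector
      (((WithLp.prodContinuousLinearEquiv 2 ℂ H
            (EuclideanSpace ℂ (Fin n))).symm.toContinuousLinearMap.comp
          ((T.prodMap N).comp
            (WithLp.prodContinuousLinearEquiv 2 ℂ H
              (EuclideanSpace ℂ (Fin n))).toContinuousLinearMap)))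
      ((WithLp.prodContinuousLinearEquiv 2 ℂ H (EuclideanSpace ℂ (Fin n))).symm (f, e)) :=
  (hf.prodMap he hTrange ⟨n, hN⟩).conj
    (WithLp.prodContinuousLinearEquiv 2 ℂ H (EuclideanSpace ℂ (Fin n)))
end

section
/- Suppose T is a hypercyclic bounded linear operator on a complex Hilbert space H. Then T ≠ 0 and the norm-one operator T/‖T‖ is not of class C_{1·}; that is, there exists a nonzero vector h ∈ H with ‖(T/‖T‖)ⁿ h‖ → 0 as n → ∞. -/
open Filter Topology

/-- `f` is a hypercyclic vector for `T`: the orbit `{Tⁿ f : n ∈ ℤ₊}` itself is dense. -/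
def IsHypercyclicVector {H : Type*} [NormedAddCommGroup H] [NormedSpace ℂ H]
    (T : H →L[ℂ] H) (f : H) : Prop :=
  Dense (Set.range fun n : ℕ => (T ^ n) f)

/-- The orbit norms of a contraction converge. -/
theorem exists_tendsto_norm_pow_apply {H : Type*} [NormedAddCommGroup H] [NormedSpace ℂ H]
    {C : H →L[ℂ] H} (hC : ‖C‖ ≤ 1) (x : H) :
    ∃ l : ℝ, Tendsto (fun n : ℕ => ‖(C ^ n) x‖) atTop (𝓝 l) := by
  refine ⟨_, tendsto_atTop_ciInf (antitone_nat_of_succ_le fun n => ?_)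
    ⟨0, by rintro _ ⟨n, rfl⟩; exact norm_nonneg _⟩⟩
  rw [pow_succ', mul_apply_eq_comp]
  exact (C.le_of_opNorm_le hC _).trans_eq (one_mul _)

/-- The powers of a contraction do not increase norms. -/
theorem norm_pow_apply_le_of_norm_le_one {H : Type*} [NormedAddCommGroup H] [NormedSpace ℂ H]
    {C : H →L[ℂ] H} (hC : ‖C‖ ≤ 1) (n : ℕ) (x : H) : ‖(C ^ n) x‖ ≤ ‖x‖ := by
  induction n with
  | zero => simp
  | succ n ih =>
    rw [pow_succ', mul_apply_eq_comp]
    exact ((C.le_of_opNorm_le hC _).trans_eq (one_mul _)).trans ih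

/-- The zero operator on a nontrivial space has no hypercyclic vector. -/
theorem IsHypercyclicVector.ne_zero {H : Type*} [NormedAddCommGroup H] [NormedSpace ℂ H]
    [Nontrivial H] {T : H →L[ℂ] H} {f : H} (hf : IsHypercyclicVector T f) : T ≠ 0 := by
  rintro rfl
  have hfin : ({f, 0} : Set H).Finite := Set.toFinite _
  have hsub : (Set.range fun n : ℕ => ((0 : H →L[ℂ] H) ^ n) f) ⊆ {f, 0} := by
    rintro _ ⟨n, rfl⟩
    cases n <;> simp
  have huniv : ({f, 0} : Set H) = Set.univ := by
    rw [← hfin.isClosed.closure_eq]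
    exact (Dense.mono hsub hf).closure_eq
  have : Infinite H := Module.Free.infinite ℂ H
  exact Set.infinite_univ (huniv ▸ hfin)

/-- A `1`-Lipschitz, absolutely homogeneous function which `T` scales by a constant factor
vanishes as soon as `T` has a hypercyclic vector. -/
theorem IsHypercyclicVector.eq_zero_of_map_eq_mul {H : Type*} [NormedAddCommGroup H]
    [NormedSpace ℂ H] {T : H →L[ℂ] H} {f : H} (hf : IsHypercyclicVector T f)
    {p : H → ℝ} {c : ℝ} (hc : 0 ≤ c) (hp0 : ∀ x, 0 ≤ p x) (hpL : ∀ x y, p x ≤ p y + ‖x - y‖)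
    (hps : ∀ (t : ℂ) x, p (t • x) = ‖t‖ * p x) (hpT : ∀ x, p (T x) = c * p x) (x : H) :
    p x = 0 := by
  have hpn (n : ℕ) : p ((T ^ n) f) = c ^ n * p f := by
    induction n with
    | zero => simp
    | succ n ih => rw [pow_succ', mul_apply_eq_comp, hpT, ih]; ring
  have happrox (y : H) {ε : ℝ} (hε : 0 < ε) : ∃ n : ℕ, ‖y - (T ^ n) f‖ < ε := by
    obtain ⟨_, ⟨n, rfl⟩, hn⟩ := Metric.dense_iff.1 hf y ε hε |>.imp fun _ h => h.symm
    exact ⟨n, by simpa [dist_eq_norm, norm_sub_rev] using hn⟩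
  have hpf : p f = 0 := by
    by_contra hne
    have hpos : 0 < p f := lt_of_le_of_ne (hp0 f) (Ne.symm hne)
    rcases le_total 1 c with h1 | h1
    · obtain ⟨n, hn⟩ := happrox 0 hpos
      have h := hpL ((T ^ n) f) 0
      have h0 : p 0 = 0 := by simpa using hps 0 0
      rw [hpn, h0, norm_sub_rev] at h
      nlinarith [one_le_pow₀ h1 (n := n)]
    · obtain ⟨n, hn⟩ := happrox ((2 : ℂ) • f) hpos
      have h := hpL ((2 : ℂ) • f) ((T ^ n) f)
      rw [hpn, hps, Complex.norm_ofNat] at h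
      nlinarith [pow_le_one₀ hc h1 (n := n)]
  refine le_antisymm (le_of_forall_pos_le_add fun ε hε => ?_) (hp0 x)
  obtain ⟨n, hn⟩ := happrox x hε
  have h := hpL x ((T ^ n) f)
  rw [hpn, hpf, mul_zero] at h
  exact h.trans (by gcongr)

/-- If `T` is a hypercyclic bounded linear operator on a (nontrivial) complex Hilbert space,
then `T ≠ 0` and the contraction `T/‖T‖` is not of class `C_{1·}`: there is a nonzero vector
`h` with `‖(T/‖T‖)ⁿ h‖ → 0`. -/
theorem stmt_3 {H : Type*} [NormedAddCommGroup H] [InnerProductSpace ℂ H] [CompleteSpace H]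
    [Nontrivial H]
    (T : H →L[ℂ] H) (hT : ∃ f, IsHypercyclicVector T f) :
    T ≠ 0 ∧ ∃ h : H, h ≠ 0 ∧
      Tendsto (fun n : ℕ => ‖((((‖T‖ : ℂ)⁻¹ • T)) ^ n) h‖) atTop (𝓝 0) := by
  obtain ⟨f, hf⟩ := hT
  have hT0 : T ≠ 0 := hf.ne_zero
  have hnT : (‖T‖ : ℂ) ≠ 0 := by simpa using hT0
  refine ⟨hT0, ?_⟩
  obtain ⟨h, hh⟩ := exists_ne (0 : H)
  refine ⟨h, hh, ?_⟩
  set C : H →L[ℂ] H := (‖T‖ : ℂ)⁻¹ • T with hCdef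
  have hC : ‖C‖ ≤ 1 := by
    rw [hCdef, norm_smul, norm_inv, Complex.norm_real, norm_norm]
    exact inv_mul_le_one
  have hTC (x : H) : T x = (‖T‖ : ℂ) • C x := by
    rw [hCdef, smul_apply, smul_inv_smul₀ hnT]
  choose p hp using exists_tendsto_norm_pow_apply hC
  have hp_zero : p h = 0 := by
    refine hf.eq_zero_of_map_eq_mul (norm_nonneg T)
      (fun x => ge_of_tendsto' (hp x) fun n => norm_nonneg _) (fun x y => ?_) (fun t x => ?_)
      (fun x => ?_) h
    · refine le_of_tendsto_of_tendsto' (hp x) ((hp y).add_const _) fun n => ?_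
      calc ‖(C ^ n) x‖ = ‖(C ^ n) y + (C ^ n) (x - y)‖ := by rw [← map_add, add_sub_cancel]
        _ ≤ ‖(C ^ n) y‖ + ‖x - y‖ := (norm_add_le _ _).trans
          (add_le_add_right (norm_pow_apply_le_of_norm_le_one hC n _) _)
    · refine tendsto_nhds_unique (hp (t • x)) (((hp x).const_mul ‖t‖).congr fun n => ?_)
      rw [map_smul, norm_smul]
    · refine tendsto_nhds_unique (hp (T x))
        ((((hp x).comp (tendsto_add_atTop_nat 1)).const_mul ‖T‖).congr fun n => ?_)
      rw [Function.comp_apply, hTC, map_smul, norm_smul, Complex.norm_real, norm_norm, pow_succ,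
        mul_apply_eq_comp]
  exact hp_zero ▸ hp h
end

section
/- Let S_λ be a weighted shift with strictly positive weights on a directed tree 𝒯 = (V, E) which is a contraction (‖S_λ‖ ≤ 1), and let A be the asymptotic limit of S_λ. Then every basis vector e_u is an eigenvector of A: A e_u = α_u e_u for all u ∈ V, where α_u = lim_{n→∞} ∑_{v ∈ Chiⁿ(u)} ∏_{j=0}^{n−1} λ_{Par^j(v)}² (this is the limit of a nonincreasing sequence in [0,1]). -/
open Filter Topology

/-- `E` is the edge relation of a directed tree on the vertex set `V`:
no loops, every vertex has at most one parent, the underlying undirected graph is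
connected (any two distinct vertices are joined by a finite undirected path), and
there is no directed circuit. -/
def IsDirectedTree {V : Type*} (E : V → V → Prop) : Prop :=
  (∀ v, ¬ E v v) ∧
  (∀ u u' v, E u v → E u' v → u = u') ∧
  (∀ u v : V, Relation.ReflTransGen (fun a b => E a b ∨ E b a) u v) ∧
  (∀ (n : ℕ) (f : Fin (n + 2) → V), Function.Injective f →
    ¬ ((∀ i : Fin (n + 1), E (f i.castSucc) (f i.succ)) ∧ E (f (Fin.last (n + 1))) (f 0)))

/-- The set `Chi(W)` of children of the vertices in `W`; its `n`-th iterate applied to `{u}`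
is `Chiⁿ(u)`. -/
def chi {V : Type*} (E : V → V → Prop) (W : Set V) : Set V :=
  {v | ∃ u ∈ W, E u v}

/-- The parent `Par(v)` of a vertex `v` (by convention `v` itself if `v` has no parent). -/
noncomputable def par {V : Type*} (E : V → V → Prop) (v : V) : V :=
  haveI := Classical.propDecidable (∃ u, E u v)
  if h : ∃ u, E u v then h.choose else v

/-- `Parⁿ(u)` exists, i.e. the whole ancestor chain of length `n` above `u` exists. -/
def parIterExists {V : Type*} (E : V → V → Prop) (n : ℕ) (u : V) : Prop :=
  ∀ j < n, ∃ w, E w ((par E)^[j] u)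

/-- The level (whole generation) `Gen(u) = ⋃_j Chi^j(Par^j(u))` of a vertex `u`. -/
def gen {V : Type*} (E : V → V → Prop) (u : V) : Set V :=
  ⋃ j : ℕ, (chi E)^[j] {(par E)^[j] u}

/-- The standard orthonormal basis vector `e_u` of `ℓ²(V)`. -/
noncomputable def evec {V : Type*} (u : V) : lp (fun _ : V => ℂ) 2 :=
  haveI := Classical.decEq V
  lp.single 2 u 1

open scoped InnerProductSpace

section DirectedTree

variable {V : Type*} {E : V → V → Prop}

lemma IsDirectedTree.par_eq (hE : IsDirectedTree E) {u v : V} (h : E u v) : par E v = u := by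
  have hex : ∃ u, E u v := ⟨u, h⟩
  rw [par, dif_pos hex]
  exact hE.2.1 _ _ _ hex.choose_spec h

lemma IsDirectedTree.mem_chi_iterate_succ (hE : IsDirectedTree E) (n : ℕ) (u v : V) :
    v ∈ (chi E)^[n + 1] {u} ↔ E (par E v) v ∧ par E v ∈ (chi E)^[n] {u} := by
  rw [Function.iterate_succ_apply']
  constructor
  · rintro ⟨w, hw, hwv⟩
    rw [hE.par_eq hwv]
    exact ⟨hwv, hw⟩
  · rintro ⟨h, hw⟩
    exact ⟨_, hw, h⟩

lemma IsDirectedTree.par_iterate_eq (hE : IsDirectedTree E) (n : ℕ) {u v : V}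
    (h : v ∈ (chi E)^[n] {u}) : (par E)^[n] v = u := by
  induction n generalizing v with
  | zero => simpa using h
  | succ n ih =>
    rw [Function.iterate_succ_apply]
    exact ih ((hE.mem_chi_iterate_succ n u v).1 h).2

lemma evec_apply_self (u : V) : (evec u : lp (fun _ : V => ℂ) 2) u = 1 := by
  simp [evec]

lemma evec_apply_of_ne {u v : V} (h : v ≠ u) : (evec u : lp (fun _ : V => ℂ) 2) v = 0 := by
  simp [evec, h]

lemma inner_evec (u : V) (x : lp (fun _ : V => ℂ) 2) : ⟪evec u, x⟫_ℂ = x u := by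
  classical
  have h := lp.inner_single_left (𝕜 := ℂ) (G := fun _ : V => ℂ) u 1 x
  simp only [evec]
  convert h using 1
  simp

variable {lam : V → ℝ} {S : lp (fun _ : V => ℂ) 2 →L[ℂ] lp (fun _ : V => ℂ) 2}

lemma IsDirectedTree.adjoint_shift_evec (hE : IsDirectedTree E)
    (hS : ∀ u v : V, (S (evec u)) v = Set.indicator {w | E u w} (fun w => (lam w : ℂ)) v) (v : V) :
    ContinuousLinearMap.adjoint S (evec v) =
      Set.indicator {w | E (par E w) w} (fun w => (lam w : ℂ)) v • evec (par E v) := by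
  ext u
  rw [← inner_evec u, ContinuousLinearMap.adjoint_inner_right, ← inner_conj_symm, inner_evec, hS]
  rw [lp.coeFn_smul, Pi.smul_apply]
  by_cases h : E u v
  · have hp := hE.par_eq h
    subst hp
    simp [h, evec_apply_self]
  · by_cases hu : u = par E v
    · subst hu
      simp [h]
    · simp [h, evec_apply_of_ne hu]

lemma IsDirectedTree.shift_apply (hE : IsDirectedTree E)
    (hS : ∀ u v : V, (S (evec u)) v = Set.indicator {w | E u w} (fun w => (lam w : ℂ)) v)
    (x : lp (fun _ : V => ℂ) 2) (v : V) :
    S x v = Set.indicator {w | E (par E w) w} (fun w => (lam w : ℂ)) v * x (par E v) := by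
  rw [← inner_evec v, ← ContinuousLinearMap.adjoint_inner_left, hE.adjoint_shift_evec hS,
    inner_smul_left, inner_evec]
  by_cases h : E (par E v) v <;> simp [h]

lemma IsDirectedTree.shift_pow_evec_apply (hE : IsDirectedTree E)
    (hS : ∀ u v : V, (S (evec u)) v = Set.indicator {w | E u w} (fun w => (lam w : ℂ)) v)
    (n : ℕ) (u v : V) :
    (S ^ n) (evec u) v = Set.indicator ((chi E)^[n] {u})
      (fun v => ((∏ j ∈ Finset.range n, lam ((par E)^[j] v) : ℝ) : ℂ)) v := by
  induction n generalizing v with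
  | zero =>
    by_cases h : v = u
    · subst h
      simp [evec_apply_self]
    · simp [h, evec_apply_of_ne h]
  | succ n ih =>
    rw [pow_succ', mul_apply_eq_comp, hE.shift_apply hS, ih]
    have hmem := hE.mem_chi_iterate_succ n u v
    by_cases h : E (par E v) v <;> by_cases h' : par E v ∈ (chi E)^[n] {u}
    · rw [Set.indicator_of_mem (hmem.2 ⟨h, h'⟩), Set.indicator_of_mem h', Finset.prod_range_succ']
      simp [h, mul_comm]
    all_goals
      have hv : v ∉ (chi E)^[n + 1] {u} := by tauto
      rw [Set.indicator_of_notMem hv]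
      simp [h, h']

lemma adjoint_pow_pow_apply (n : ℕ) (w : V) (x : lp (fun _ : V => ℂ) 2) :
    ((ContinuousLinearMap.adjoint S) ^ n) ((S ^ n) x) w = ⟪(S ^ n) (evec w), (S ^ n) x⟫_ℂ := by
  rw [← inner_evec w, ← ContinuousLinearMap.star_eq_adjoint, ← star_pow,
    ContinuousLinearMap.star_eq_adjoint, ContinuousLinearMap.adjoint_inner_right]

lemma IsDirectedTree.adjoint_pow_pow_evec_apply_self (hE : IsDirectedTree E)
    (hS : ∀ u v : V, (S (evec u)) v = Set.indicator {w | E u w} (fun w => (lam w : ℂ)) v)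
    (n : ℕ) (u : V) :
    ((ContinuousLinearMap.adjoint S) ^ n) ((S ^ n) (evec u)) u =
      ((∑' v : V, Set.indicator ((chi E)^[n] {u})
        (fun v => ∏ j ∈ Finset.range n, (lam ((par E)^[j] v)) ^ 2) v : ℝ) : ℂ) := by
  rw [adjoint_pow_pow_apply, lp.inner_eq_tsum, Complex.ofReal_tsum]
  refine tsum_congr fun v => ?_
  rw [hE.shift_pow_evec_apply hS]
  by_cases h : v ∈ (chi E)^[n] {u}
  · rw [Set.indicator_of_mem h, Set.indicator_of_mem h, Finset.prod_pow, RCLike.inner_apply,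
      Complex.conj_ofReal, ← Complex.ofReal_mul, sq]
  · simp [h]

lemma IsDirectedTree.adjoint_pow_pow_evec_apply_of_ne (hE : IsDirectedTree E)
    (hS : ∀ u v : V, (S (evec u)) v = Set.indicator {w | E u w} (fun w => (lam w : ℂ)) v)
    (n : ℕ) {u w : V} (hw : w ≠ u) :
    ((ContinuousLinearMap.adjoint S) ^ n) ((S ^ n) (evec u)) w = 0 := by
  rw [adjoint_pow_pow_apply, lp.inner_eq_tsum]
  refine (tsum_congr fun v => ?_).trans tsum_zero
  rw [hE.shift_pow_evec_apply hS, hE.shift_pow_evec_apply hS]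
  by_cases h : v ∈ (chi E)^[n] {u}
  · have h' : v ∉ (chi E)^[n] {w} := fun h' =>
      hw ((hE.par_iterate_eq n h').symm.trans (hE.par_iterate_eq n h))
    simp [h']
  · simp [h]

end DirectedTree

/-- The asymptotic limit `A` of a contractive weighted shift on a directed tree is diagonal:
`A e_u = α_u e_u` where `α_u = lim_n ∑_{v ∈ Chiⁿ(u)} ∏_{j<n} λ_{Par^j(v)}²`. -/
theorem stmt_5 {V : Type*} (E : V → V → Prop) (hE : IsDirectedTree E)
    (lam : V → ℝ) (hlam : ∀ v, (∃ u, E u v) → 0 < lam v)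
    (S : lp (fun _ : V => ℂ) 2 →L[ℂ] lp (fun _ : V => ℂ) 2)
    (hS : ∀ u v : V, (S (evec u)) v = Set.indicator {w | E u w} (fun w => (lam w : ℂ)) v)
    (hcon : ‖S‖ ≤ 1)
    (A : lp (fun _ : V => ℂ) 2 →L[ℂ] lp (fun _ : V => ℂ) 2)
    (hA : ∀ x, Tendsto (fun n : ℕ => ((ContinuousLinearMap.adjoint S) ^ n) ((S ^ n) x))
      atTop (𝓝 (A x))) :
    ∀ u : V, ∃ α : ℝ,
      Tendsto (fun n : ℕ => ∑' v : V,
          Set.indicator ((chi E)^[n] {u})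
            (fun v => ∏ j ∈ Finset.range n, (lam ((par E)^[j] v)) ^ 2) v)
        atTop (𝓝 α) ∧
      A (evec u) = (α : ℂ) • evec u := by
  intro u
  have hlim : ∀ w, Tendsto (fun n : ℕ =>
      ((ContinuousLinearMap.adjoint S) ^ n) ((S ^ n) (evec u)) w) atTop (𝓝 (A (evec u) w)) := by
    intro w
    simpa only [inner_evec] using (tendsto_const_nhds (x := evec w)).inner (𝕜 := ℂ) (hA (evec u))
  have hself := hlim u
  simp only [hE.adjoint_pow_pow_evec_apply_self hS] at hself
  have hre := (Complex.continuous_re.tendsto _).comp hself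
  refine ⟨(A (evec u) u).re, hre, ?_⟩
  ext w
  rw [lp.coeFn_smul, Pi.smul_apply]
  by_cases hw : w = u
  · subst hw
    rw [evec_apply_self, smul_eq_mul, mul_one]
    exact tendsto_nhds_unique hself ((Complex.continuous_ofReal.tendsto _).comp hre)
  · rw [evec_apply_of_ne hw, smul_zero]
    have hzero := hlim w
    simp only [hE.adjoint_pow_pow_evec_apply_of_ne hS _ hw] at hzero
    exact tendsto_nhds_unique hzero tendsto_const_nhds
end

section
/- If the directed tree 𝒯 = (V, E) has a root and S_λ is a contractive weighted shift with strictly positive weights on 𝒯, then S_λ is of class C_{·0}; that is, ‖S_λ*ⁿ h‖ → 0 as n → ∞ for every h ∈ ℓ²(V). -/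
open Filter Topology

/-- For a contraction `T`, the set of vectors `x` with `‖T ^ n x‖ → 0` is closed. -/
theorem isClosed_setOf_tendsto_norm_pow_apply {𝕜 H : Type*} [NontriviallyNormedField 𝕜]
    [NormedAddCommGroup H] [NormedSpace 𝕜 H] (T : H →L[𝕜] H) (hT : ‖T‖ ≤ 1) :
    IsClosed {x : H | Tendsto (fun n : ℕ => ‖(T ^ n) x‖) atTop (𝓝 0)} := by
  have hle : ∀ (n : ℕ) (x : H), ‖(T ^ n) x‖ ≤ ‖x‖ := by
    intro n x
    induction n with
    | zero => simp
    | succ n ih =>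
      rw [pow_succ']
      exact ((T.le_of_opNorm_le hT _).trans_eq (one_mul _)).trans ih
  refine isClosed_of_closure_subset fun x hx => ?_
  rw [Set.mem_ofPred_eq, Metric.tendsto_atTop]
  intro ε hε
  obtain ⟨y, hy, hxy⟩ := Metric.mem_closure_iff.1 hx (ε / 2) (half_pos hε)
  obtain ⟨N, hN⟩ := Metric.tendsto_atTop.1 hy (ε / 2) (half_pos hε)
  refine ⟨N, fun n hn => ?_⟩
  have hyn := hN n hn
  rw [dist_zero_right, norm_norm] at hyn ⊢
  rw [dist_eq_norm] at hxy
  calc ‖(T ^ n) x‖ = ‖(T ^ n) (x - y) + (T ^ n) y‖ := by rw [← map_add, sub_add_cancel]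
    _ ≤ ‖(T ^ n) (x - y)‖ + ‖(T ^ n) y‖ := norm_add_le _ _
    _ ≤ ‖x - y‖ + ‖(T ^ n) y‖ := by gcongr; exact hle n _
    _ < ε := by linarith

/-- The inner product with `e_u` is the coordinate at `u`. -/
theorem inner_evec_left {V : Type*} (u : V) (f : lp (fun _ : V => ℂ) 2) :
    inner ℂ (evec u) f = f u := by
  let := Classical.decEq V
  simp [evec, lp.inner_single_left]

/-- The coordinates of `e_u`. -/
theorem evec_apply {V : Type*} [DecidableEq V] (u v : V) :
    evec u v = if v = u then 1 else 0 := by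
  by_cases h : v = u
  · subst h
    simp [evec]
  · simp [evec, h]

/-- A closed subspace of `ℓ²(V)` containing every `e_u` is everything. -/
theorem mem_of_isClosed_of_forall_evec_mem {V : Type*}
    (M : Submodule ℂ (lp (fun _ : V => ℂ) 2)) (hM : IsClosed (M : Set (lp (fun _ : V => ℂ) 2)))
    (he : ∀ u, evec u ∈ M) (f : lp (fun _ : V => ℂ) 2) : f ∈ M := by
  classical
  have hsum := lp.hasSum_single (p := 2) (by simp) f
  refine hM.mem_of_tendsto hsum (Eventually.of_forall fun s => M.sum_mem fun u _ => ?_)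
  have : lp.single 2 u (f u) = f u • evec (V := V) u := by
    ext v
    rw [lp.coeFn_smul, Pi.smul_apply, evec_apply, lp.single_apply, Pi.single_apply]
    simp
  rw [this]
  exact M.smul_mem _ (he u)

/-- The coordinates of `S* e_v` for a weighted shift `S`. -/
theorem adjoint_weightedShift_evec_apply {V : Type*} {E : V → V → Prop} {lam : V → ℝ}
    {S : lp (fun _ : V => ℂ) 2 →L[ℂ] lp (fun _ : V => ℂ) 2}
    (hS : ∀ u v : V, (S (evec u)) v = Set.indicator {w | E u w} (fun w => (lam w : ℂ)) v)
    (u v : V) :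
    ContinuousLinearMap.adjoint S (evec v) u =
      Set.indicator {w | E u w} (fun w => (lam w : ℂ)) v := by
  rw [← inner_evec_left, ContinuousLinearMap.adjoint_inner_right, ← inner_conj_symm,
    inner_evec_left, hS]
  by_cases h : E u v <;> simp [Set.indicator, h]

/-- The adjoint of a weighted shift kills `e_r` when `r` has no parent. -/
theorem adjoint_weightedShift_evec_root {V : Type*} {E : V → V → Prop} {lam : V → ℝ}
    {S : lp (fun _ : V => ℂ) 2 →L[ℂ] lp (fun _ : V => ℂ) 2}
    (hS : ∀ u v : V, (S (evec u)) v = Set.indicator {w | E u w} (fun w => (lam w : ℂ)) v)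
    {r : V} (hr : ∀ u, ¬ E u r) : ContinuousLinearMap.adjoint S (evec r) = 0 := by
  ext u
  rw [adjoint_weightedShift_evec_apply hS]
  simp [hr u]

/-- The adjoint of a weighted shift maps `e_v` to `λ_v e_u`, where `u` is the parent of `v`. -/
theorem adjoint_weightedShift_evec_of_edge {V : Type*} {E : V → V → Prop} {lam : V → ℝ}
    (hE : ∀ u u' v, E u v → E u' v → u = u')
    {S : lp (fun _ : V => ℂ) 2 →L[ℂ] lp (fun _ : V => ℂ) 2}
    (hS : ∀ u v : V, (S (evec u)) v = Set.indicator {w | E u w} (fun w => (lam w : ℂ)) v)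
    {u v : V} (huv : E u v) :
    ContinuousLinearMap.adjoint S (evec v) = (lam v : ℂ) • evec u := by
  classical
  ext w
  rw [adjoint_weightedShift_evec_apply hS, lp.coeFn_smul, Pi.smul_apply, evec_apply]
  by_cases hw : w = u
  · subst hw
    simp [huv]
  · have : ¬ E w v := fun h => hw (hE _ _ _ h huv)
    simp [hw, this]

/-- If the directed tree has a root, then every contractive weighted shift on it is of class
`C_{·0}`: `‖S_λ*ⁿ h‖ → 0` for every `h ∈ ℓ²(V)`. -/
theorem stmt_7 {V : Type*} (E : V → V → Prop) (hE : IsDirectedTree E)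
    (hroot : ∃ r : V, ∀ u, ¬ E u r)
    (lam : V → ℝ) (hlam : ∀ v, (∃ u, E u v) → 0 < lam v)
    (S : lp (fun _ : V => ℂ) 2 →L[ℂ] lp (fun _ : V => ℂ) 2)
    (hS : ∀ u v : V, (S (evec u)) v = Set.indicator {w | E u w} (fun w => (lam w : ℂ)) v)
    (hcon : ‖S‖ ≤ 1) :
    ∀ h : lp (fun _ : V => ℂ) 2,
      Tendsto (fun n : ℕ => ‖((ContinuousLinearMap.adjoint S) ^ n) h‖) atTop (𝓝 0) := by
  obtain ⟨-, hpar, hconn, -⟩ := hE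
  obtain ⟨r, hr⟩ := hroot
  set T := ContinuousLinearMap.adjoint S with hTdef
  have hT : ‖T‖ ≤ 1 := by rwa [hTdef, LinearIsometryEquiv.norm_map]
  let M : Submodule ℂ (lp (fun _ : V => ℂ) 2) :=
    { carrier := {x | Tendsto (fun n : ℕ => ‖(T ^ n) x‖) atTop (𝓝 0)}
      zero_mem' := by simp
      add_mem' := fun {x y} hx hy => by
        simp only [Set.mem_ofPred_eq, ← tendsto_zero_iff_norm_tendsto_zero, map_add] at hx hy ⊢
        simpa using hx.add hy
      smul_mem' := fun c x hx => by
        simp only [Set.mem_ofPred_eq, ← tendsto_zero_iff_norm_tendsto_zero, map_smul] at hx ⊢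
        simpa using hx.const_smul c }
  have hMT : ∀ x, T x ∈ M ↔ x ∈ M := fun x => by
    change Tendsto (fun n : ℕ => ‖(T ^ n) (T x)‖) atTop (𝓝 0) ↔
      Tendsto (fun n : ℕ => ‖(T ^ n) x‖) atTop (𝓝 0)
    rw [← tendsto_add_atTop_iff_nat (f := fun n : ℕ => ‖(T ^ n) x‖) 1]
    simp only [pow_succ, mul_apply_eq_comp]
  have hedge : ∀ u v, E u v → (evec v ∈ M ↔ evec u ∈ M) := fun u v huv => by
    have hne : (lam v : ℂ) ≠ 0 := Complex.ofReal_ne_zero.2 (hlam v ⟨u, huv⟩).ne'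
    rw [← hMT, adjoint_weightedShift_evec_of_edge hpar hS huv, M.smul_mem_iff hne]
  have hmem : ∀ v, evec v ∈ M := fun v => by
    induction hconn r v with
    | refl => exact (hMT _).1 (adjoint_weightedShift_evec_root hS hr ▸ M.zero_mem)
    | tail _ hab ih =>
      rcases hab with hab | hab
      · exact (hedge _ _ hab).2 ih
      · exact (hedge _ _ hab).1 ih
  exact mem_of_isClosed_of_forall_evec_mem M (isClosed_setOf_tendsto_norm_pow_apply T hT) hmem
end

section
/- Let H be a complex Hilbert space with orthonormal basis {e_{j,k} : j ∈ J, k ∈ ℤ₊}, where J is a nonempty countable set, let {w_{j,k} : j ∈ J, k ∈ ℤ₊} ⊆ [0, ∞) be a bounded set of weights, and let B be the bounded weighted backward shift on H defined by B e_{j,0} = 0 and B e_{j,k} = w_{j,k−1} e_{j,k−1} for k ≥ 1. Then B is cyclic if and only if at most one of the weights w_{j,k} is zero. -/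
open Filter Topology

open Polynomial in
theorem aeval_apply_mem_span_orbit {H : Type*} [NormedAddCommGroup H] [NormedSpace ℂ H]
    (T : H →L[ℂ] H) (f : H) (p : ℂ[X]) :
    aeval T p f ∈ Submodule.span ℂ (Set.range fun n : ℕ => (T ^ n) f) := by
  rw [aeval_eq_sum_range, sum_apply]
  refine Submodule.sum_mem _ fun i _ => ?_
  rw [smul_apply]
  exact Submodule.smul_mem _ _ (Submodule.subset_span ⟨i, rfl⟩)

open Polynomial in
/-- A Baire category criterion: if the polynomials in `T` act topologically transitively, then
`T` has a cyclic vector. -/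
theorem exists_isCyclicVector_of_transitive {H : Type*} [NormedAddCommGroup H] [NormedSpace ℂ H]
    [CompleteSpace H] [SecondCountableTopology H] (T : H →L[ℂ] H)
    (hT : ∀ U V : Set H, IsOpen U → U.Nonempty → IsOpen V → V.Nonempty →
      ∃ x ∈ U, ∃ p : ℂ[X], aeval T p x ∈ V) :
    ∃ f, IsCyclicVector T f := by
  let b := TopologicalSpace.countableBasis H
  have hb : TopologicalSpace.IsTopologicalBasis b := TopologicalSpace.isBasis_countableBasis H
  let G : b → Set H := fun V => ⋃ p : ℂ[X], (aeval T p : H →L[ℂ] H) ⁻¹' (V : Set H)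
  have hopen : ∀ V, IsOpen (G V) := fun V =>
    isOpen_iUnion fun p => (hb.isOpen V.2).preimage (aeval T p : H →L[ℂ] H).continuous
  have hdense : ∀ V, Dense (G V) := by
    intro V
    rw [dense_iff_inter_open]
    intro U hU hUne
    obtain ⟨x, hx, p, hp⟩ := hT U V hU hUne (hb.isOpen V.2)
      (TopologicalSpace.nonempty_of_mem_countableBasis V.2)
    exact ⟨x, hx, Set.mem_iUnion.2 ⟨p, hp⟩⟩
  have : Countable b := (TopologicalSpace.countable_countableBasis H).to_subtype
  obtain ⟨f, hf⟩ := (dense_iInter_of_isOpen hopen hdense).nonempty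
  refine ⟨f, ?_⟩
  rw [IsCyclicVector, ← Submodule.dense_iff_topologicalClosure_eq_top, hb.dense_iff]
  intro V hV _
  obtain ⟨p, hp⟩ := Set.mem_iUnion.1 (Set.mem_iInter.1 hf ⟨V, hV⟩)
  exact ⟨_, hp, aeval_apply_mem_span_orbit T f p⟩

theorem exists_mem_pow_apply_eq {H : Type*} [NormedAddCommGroup H] [NormedSpace ℂ H]
    {T : H →L[ℂ] H} {M : Submodule ℂ H} (hM : ∀ y ∈ M, ∃ x ∈ M, T x = y) (n : ℕ) :
    ∀ y ∈ M, ∃ x ∈ M, (T ^ n) x = y := by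
  induction n with
  | zero => exact fun y hy => ⟨y, hy, rfl⟩
  | succ n ih =>
    intro y hy
    obtain ⟨z, hz, rfl⟩ := ih y hy
    obtain ⟨x, hx, rfl⟩ := hM z hz
    exact ⟨x, hx, by rw [pow_succ]; rfl⟩

open Polynomial in
/-- If `T` maps a subspace `M` onto itself and there are densely many `f` in the generalized
kernel of `T` whose orbit spans a dense set modulo `M`, then `T` is cyclic. -/
theorem exists_isCyclicVector_of_surjOn {H : Type*} [NormedAddCommGroup H] [NormedSpace ℂ H]
    [CompleteSpace H] [SecondCountableTopology H] (T : H →L[ℂ] H) (E M : Submodule ℂ H)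
    (hE : Dense (E : Set H)) (hM : ∀ y ∈ M, ∃ x ∈ M, T x = y)
    (hf : ∀ U : Set H, IsOpen U → U.Nonempty → ∃ f ∈ U, (∃ n, (T ^ n) f = 0) ∧
      ∀ g ∈ E, ∃ r : ℂ[X], g - aeval T r f ∈ M) :
    ∃ f, IsCyclicVector T f := by
  refine exists_isCyclicVector_of_transitive T fun U V hU hUne hV hVne => ?_
  obtain ⟨f, hfU, ⟨n, hn⟩, hfE⟩ := hf U hU hUne
  obtain ⟨g, hgV, hgE⟩ := hE.inter_open_nonempty V hV hVne
  obtain ⟨r, hr⟩ := hfE g hgE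
  obtain ⟨h, -, hh⟩ := exists_mem_pow_apply_eq hM n _ hr
  have h1 : ∀ᶠ δ : ℂ in 𝓝 0, f + δ • h ∈ U := by
    have : ContinuousAt (fun δ : ℂ => f + δ • h) 0 := by fun_prop
    exact this.eventually_mem (hU.mem_nhds (by simpa using hfU))
  have h2 : ∀ᶠ δ : ℂ in 𝓝 0, g + δ • aeval T r h ∈ V := by
    have : ContinuousAt (fun δ : ℂ => g + δ • aeval T r h) 0 := by fun_prop
    exact this.eventually_mem (hV.mem_nhds (by simpa using hgV))
  obtain ⟨δ, ⟨hδU, hδV⟩, hδ⟩ :=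
    (((h1.and h2).filter_mono nhdsWithin_le_nhds).and
      (eventually_mem_nhdsWithin (a := (0 : ℂ)) (s := {0}ᶜ))).exists
  have hδ0 : δ ≠ 0 := hδ
  refine ⟨_, hδU, r + C δ⁻¹ * X ^ n, ?_⟩
  convert hδV using 1
  have hg : g = aeval T r f + (T ^ n) h := by rw [hh]; abel
  rw [hg]
  simp only [map_add, map_mul, aeval_C, map_pow, aeval_X, add_apply,
    mul_apply_eq_comp, Algebra.algebraMap_eq_smul_one, smul_apply,
    one_apply_eq_self, map_smul, hn, smul_zero, smul_add, add_zero,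
    smul_inv_smul₀ hδ0]
  abel

theorem HilbertBasis.secondCountableTopology {ι H : Type*} [Countable ι] [NormedAddCommGroup H]
    [InnerProductSpace ℂ H] (e : HilbertBasis ι ℂ H) : SecondCountableTopology H := by
  have h : TopologicalSpace.IsSeparable
      (closure (Submodule.span ℂ (Set.range e) : Set H)) :=
    ((Set.countable_range e).isSeparable.span (R := ℂ)).closure
  rw [← Submodule.topologicalClosure_coe, e.dense_span, Submodule.top_coe,
    TopologicalSpace.isSeparable_univ_iff] at h
  exact UniformSpace.secondCountable_of_separable H

section WeightedShift

variable {H : Type*} [NormedAddCommGroup H] [InnerProductSpace ℂ H] {J : Type*}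
  {e : HilbertBasis (J × ℕ) ℂ H} {w : J → ℕ → ℝ} {B : H →L[ℂ] H}

theorem exists_pow_apply_eq_zero_of_mem_span (hB0 : ∀ j : J, B (e (j, 0)) = 0)
    (hB : ∀ (j : J) (k : ℕ), B (e (j, k + 1)) = ((w j k : ℝ) : ℂ) • e (j, k))
    {x : H} (hx : x ∈ Submodule.span ℂ (Set.range e)) : ∃ n, (B ^ n) x = 0 := by
  have hmono : ∀ {x : H} {m n : ℕ}, m ≤ n → (B ^ m) x = 0 → (B ^ n) x = 0 := by
    intro x m n hmn h
    rw [← Nat.sub_add_cancel hmn, pow_add, mul_apply_eq_comp, h, map_zero]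
  induction hx using Submodule.span_induction with
  | mem x hx =>
    obtain ⟨⟨j, k⟩, rfl⟩ := hx
    refine ⟨k + 1, ?_⟩
    induction k with
    | zero => simpa using hB0 j
    | succ k ih => rw [pow_succ, mul_apply_eq_comp, hB, map_smul, ih, smul_zero]
  | zero => exact ⟨0, map_zero _⟩
  | add x y _ _ hx hy =>
    obtain ⟨m, hm⟩ := hx
    obtain ⟨n, hn⟩ := hy
    exact ⟨max m n, by rw [map_add, hmono (le_max_left m n) hm, hmono (le_max_right m n) hn,
      add_zero]⟩
  | smul a x _ hx =>
    obtain ⟨m, hm⟩ := hx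
    exact ⟨m, by rw [map_smul, hm, smul_zero]⟩

/-- `B` maps the span of a set of basis vectors that is closed under raising the second index and
avoids the zero weights onto (at least) itself. -/
theorem exists_mem_span_image_apply_eq
    (hB : ∀ (j : J) (k : ℕ), B (e (j, k + 1)) = ((w j k : ℝ) : ℂ) • e (j, k))
    {S : Set (J × ℕ)} (hS : ∀ j k, (j, k) ∈ S → (j, k + 1) ∈ S ∧ w j k ≠ 0) :
    ∀ y ∈ Submodule.span ℂ (e '' S), ∃ x ∈ Submodule.span ℂ (e '' S), B x = y := by
  have : Submodule.span ℂ (e '' S) ≤ (Submodule.span ℂ (e '' S)).map (B : H →ₗ[ℂ] H) := by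
    rw [Submodule.span_le]
    rintro _ ⟨⟨j, k⟩, hjk, rfl⟩
    obtain ⟨h1, h2⟩ := hS j k hjk
    refine ⟨((w j k : ℝ) : ℂ)⁻¹ • e (j, k + 1),
      Submodule.smul_mem _ _ (Submodule.subset_span ⟨_, h1, rfl⟩), ?_⟩
    rw [ContinuousLinearMap.coe_coe, map_smul, hB, smul_smul,
      inv_mul_cancel₀ (Complex.ofReal_ne_zero.2 h2), one_smul]
  exact fun y hy => this hy

/-- The functional `x ↦ ⟪e p, x⟫` annihilates the range of `B` if the weight at `p` is zero. -/
theorem inner_apply_eq_zero_of_weight_eq_zero (hB0 : ∀ j : J, B (e (j, 0)) = 0)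
    (hB : ∀ (j : J) (k : ℕ), B (e (j, k + 1)) = ((w j k : ℝ) : ℂ) • e (j, k))
    {p : J × ℕ} (hp : w p.1 p.2 = 0) (x : H) : inner ℂ (e p) (B x) = 0 := by
  classical
  suffices h : (innerSL ℂ (e p)).comp B = 0 from DFunLike.congr_fun h x
  refine ContinuousLinearMap.ext_on (s := Set.range e)
    (Submodule.dense_iff_topologicalClosure_eq_top.2 e.dense_span) ?_
  rintro _ ⟨⟨j, _ | k⟩, rfl⟩
  · simp [hB0]
  · simp only [ContinuousLinearMap.comp_apply, hB, map_smul, innerSL_apply_apply,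
      zero_apply, smul_eq_mul, orthonormal_iff_ite.1 e.orthonormal]
    split_ifs with h
    · subst h; simpa using hp
    · simp

theorem IsCyclicVector.subsingleton_zero_weights (hB0 : ∀ j : J, B (e (j, 0)) = 0)
    (hB : ∀ (j : J) (k : ℕ), B (e (j, k + 1)) = ((w j k : ℝ) : ℂ) • e (j, k))
    {f : H} (hf : IsCyclicVector B f) : {p : J × ℕ | w p.1 p.2 = 0}.Subsingleton := by
  classical
  intro p hp q hq
  by_contra hpq
  have key : ∀ a b : ℂ, a * inner ℂ (e p) f + b * inner ℂ (e q) f = 0 →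
      a • innerSL ℂ (e p) + b • innerSL ℂ (e q) = 0 := by
    intro a b hab
    refine ContinuousLinearMap.ext_on (s := Set.range fun n : ℕ => (B ^ n) f)
      (Submodule.dense_iff_topologicalClosure_eq_top.2 hf) ?_
    rintro _ ⟨_ | n, rfl⟩
    · simpa using hab
    · simp only [pow_succ', mul_apply_eq_comp, add_apply,
        smul_apply, innerSL_apply_apply,
        inner_apply_eq_zero_of_weight_eq_zero hB0 hB hp,
        inner_apply_eq_zero_of_weight_eq_zero hB0 hB hq]
      simp
  have coord : ∀ a b : ℂ, a * inner ℂ (e p) f + b * inner ℂ (e q) f = 0 → a = 0 ∧ b = 0 := by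
    intro a b hab
    have h := key a b hab
    have h1 := DFunLike.congr_fun h (e p)
    have h2 := DFunLike.congr_fun h (e q)
    simp only [add_apply, smul_apply,
      innerSL_apply_apply, orthonormal_iff_ite.1 e.orthonormal, hpq, Ne.symm hpq,
      zero_apply] at h1 h2
    exact ⟨by simpa using h1, by simpa using h2⟩
  obtain ⟨h1, h2⟩ := coord (inner ℂ (e q) f) (-inner ℂ (e p) f) (by ring)
  exact one_ne_zero (coord 1 0 (by rw [neg_eq_zero.1 h2]; ring)).1

/-- The indices off the initial segment `{(j₀, k) : i ≤ k ≤ k₀}` of the branch `j₀`. -/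
def offBlock (j₀ : J) (k₀ i : ℕ) : Set (J × ℕ) :=
  {p | p.1 = j₀ → p.2 < i ∨ k₀ < p.2}

theorem offBlock_succ (j₀ : J) (k₀ i : ℕ) :
    offBlock j₀ k₀ (i + 1) = insert (j₀, i) (offBlock j₀ k₀ i) := by
  ext ⟨j, k⟩
  simp only [offBlock, Set.mem_ofPred_eq, Set.mem_insert_iff, Prod.mk.injEq]
  by_cases h : j = j₀ <;> simp [h]
  omega

theorem offBlock_eq_univ (j₀ : J) (k₀ : ℕ) : offBlock j₀ k₀ (k₀ + 1) = Set.univ := by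
  ext ⟨j, k⟩
  simp only [offBlock, Set.mem_ofPred_eq, Set.mem_univ, iff_true]
  omega

theorem apply_mem_span_offBlock (hB0 : ∀ j : J, B (e (j, 0)) = 0)
    (hB : ∀ (j : J) (k : ℕ), B (e (j, k + 1)) = ((w j k : ℝ) : ℂ) • e (j, k))
    {j₀ : J} {k₀ : ℕ} (h0 : w j₀ k₀ = 0) (i : ℕ) {x : H}
    (hx : x ∈ Submodule.span ℂ (e '' offBlock j₀ k₀ (i + 1))) :
    B x ∈ Submodule.span ℂ (e '' offBlock j₀ k₀ i) := by
  suffices h : Submodule.span ℂ (e '' offBlock j₀ k₀ (i + 1)) ≤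
      (Submodule.span ℂ (e '' offBlock j₀ k₀ i)).comap (B : H →ₗ[ℂ] H) from h hx
  rw [Submodule.span_le]
  rintro _ ⟨⟨j, _ | k⟩, hjk, rfl⟩
  · simp [hB0]
  · simp only [SetLike.mem_coe, Submodule.mem_comap, ContinuousLinearMap.coe_coe, hB]
    by_cases hz : j = j₀ ∧ k = k₀
    · simp [hz.1, hz.2, h0]
    · refine Submodule.smul_mem _ _ (Submodule.subset_span ⟨_, ?_, rfl⟩)
      simp only [offBlock, Set.mem_ofPred_eq] at hjk ⊢
      intro hj
      have := hjk hj
      have : k ≠ k₀ := fun hk => hz ⟨hj, hk⟩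
      omega

/-- Applying powers of `B` to a vector whose coordinate at `(j₀, k₀)` is nonzero lowers the
leading index on the block `{(j₀, k) : k ≤ k₀}`. -/
theorem exists_leading_coeff (hB0 : ∀ j : J, B (e (j, 0)) = 0)
    (hB : ∀ (j : J) (k : ℕ), B (e (j, k + 1)) = ((w j k : ℝ) : ℂ) • e (j, k))
    {j₀ : J} {k₀ : ℕ} (h0 : w j₀ k₀ = 0) (hne : ∀ k < k₀, w j₀ k ≠ 0) {f : H} {c : ℂ}
    (hc : c ≠ 0) (hf : f - c • e (j₀, k₀) ∈ Submodule.span ℂ (e '' offBlock j₀ k₀ k₀))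
    (m i : ℕ) (hmi : m + i = k₀) :
    ∃ d : ℂ, d ≠ 0 ∧
      (B ^ m) f - d • e (j₀, i) ∈ Submodule.span ℂ (e '' offBlock j₀ k₀ i) := by
  induction m generalizing i with
  | zero =>
    obtain rfl : i = k₀ := by omega
    exact ⟨c, hc, hf⟩
  | succ m ih =>
    obtain ⟨d, hd, h⟩ := ih (i + 1) (by omega)
    refine ⟨d * (w j₀ i : ℝ), mul_ne_zero hd (Complex.ofReal_ne_zero.2 (hne i (by omega))), ?_⟩
    have := apply_mem_span_offBlock hB0 hB h0 i h
    rwa [map_sub, map_smul, hB, smul_smul, ← mul_apply_eq_comp, ← pow_succ'] at this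

open Polynomial in
theorem exists_aeval_sub_mem_span_offBlock (hB0 : ∀ j : J, B (e (j, 0)) = 0)
    (hB : ∀ (j : J) (k : ℕ), B (e (j, k + 1)) = ((w j k : ℝ) : ℂ) • e (j, k))
    {j₀ : J} {k₀ : ℕ} (h0 : w j₀ k₀ = 0) (hne : ∀ k < k₀, w j₀ k ≠ 0) {f : H} {c : ℂ}
    (hc : c ≠ 0) (hf : f - c • e (j₀, k₀) ∈ Submodule.span ℂ (e '' offBlock j₀ k₀ k₀))
    (i : ℕ) (hi : i ≤ k₀ + 1) (g : H) (hg : g ∈ Submodule.span ℂ (e '' offBlock j₀ k₀ i)) :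
    ∃ r : ℂ[X], g - aeval B r f ∈ Submodule.span ℂ (e '' offBlock j₀ k₀ 0) := by
  induction i generalizing g with
  | zero => exact ⟨0, by simpa using hg⟩
  | succ i ih =>
    rw [offBlock_succ, Set.image_insert_eq, Submodule.mem_span_insert] at hg
    obtain ⟨a, z, hz, rfl⟩ := hg
    obtain ⟨d, hd, h⟩ := exists_leading_coeff hB0 hB h0 hne hc hf (k₀ - i) i (by omega)
    obtain ⟨r, hr⟩ := ih (by omega) _
      (Submodule.sub_mem _ hz (Submodule.smul_mem _ (a * d⁻¹) h))
    refine ⟨r + C (a * d⁻¹) * X ^ (k₀ - i), ?_⟩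
    convert hr using 1
    simp only [map_add, map_mul, aeval_C, map_pow, aeval_X, add_apply,
      mul_apply_eq_comp, Algebra.algebraMap_eq_smul_one,
      smul_apply, one_apply_eq_self, smul_sub, smul_smul,
      inv_mul_cancel_right₀ hd]
    abel

theorem exists_isCyclicVector_of_weights_ne_zero [CompleteSpace H] [Countable J]
    (hB0 : ∀ j : J, B (e (j, 0)) = 0)
    (hB : ∀ (j : J) (k : ℕ), B (e (j, k + 1)) = ((w j k : ℝ) : ℂ) • e (j, k))
    (hne : ∀ j k, w j k ≠ 0) : ∃ f, IsCyclicVector B f := by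
  have := e.secondCountableTopology
  have hE := Submodule.dense_iff_topologicalClosure_eq_top.2 e.dense_span
  refine exists_isCyclicVector_of_surjOn B _ (Submodule.span ℂ (Set.range e)) hE ?_ ?_
  · rw [← Set.image_univ]
    exact exists_mem_span_image_apply_eq hB fun j k _ => ⟨trivial, hne j k⟩
  · intro U hU hUne
    obtain ⟨f, hfU, hfE⟩ := hE.inter_open_nonempty U hU hUne
    exact ⟨f, hfU, exists_pow_apply_eq_zero_of_mem_span hB0 hB hfE,
      fun g hg => ⟨0, by simpa using hg⟩⟩

theorem exists_isCyclicVector_of_unique_zero_weight [CompleteSpace H] [Countable J]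
    (hB0 : ∀ j : J, B (e (j, 0)) = 0)
    (hB : ∀ (j : J) (k : ℕ), B (e (j, k + 1)) = ((w j k : ℝ) : ℂ) • e (j, k))
    {j₀ : J} {k₀ : ℕ} (h0 : w j₀ k₀ = 0) (hne : ∀ j k, w j k = 0 → j = j₀ ∧ k = k₀) :
    ∃ f, IsCyclicVector B f := by
  have := e.secondCountableTopology
  have hE := Submodule.dense_iff_topologicalClosure_eq_top.2 e.dense_span
  have hspan : Submodule.span ℂ (Set.range e) =
      Submodule.span ℂ (e '' offBlock j₀ k₀ (k₀ + 1)) := by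
    rw [offBlock_eq_univ, Set.image_univ]
  refine exists_isCyclicVector_of_surjOn B _ (Submodule.span ℂ (e '' offBlock j₀ k₀ 0)) hE ?_ ?_
  · refine exists_mem_span_image_apply_eq hB fun j k hjk => ?_
    simp only [offBlock, Set.mem_ofPred_eq] at hjk ⊢
    refine ⟨fun hj => ?_, fun hz => ?_⟩
    · have := hjk hj
      omega
    · obtain ⟨hj, hk⟩ := hne j k hz
      have := hjk hj
      omega
  · intro U hU hUne
    obtain ⟨x, hxU, hxE⟩ := hE.inter_open_nonempty U hU hUne
    have hx := hxE
    rw [SetLike.mem_coe, hspan, offBlock_succ, Set.image_insert_eq,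
      Submodule.mem_span_insert] at hx
    obtain ⟨c, z, hz, hxz⟩ := hx
    have hcont : Continuous fun t : ℂ => x + t • e (j₀, k₀) := by fun_prop
    obtain ⟨t, htU, ht⟩ := (dense_compl_singleton (-c)).inter_open_nonempty _
      (hU.preimage hcont) ⟨0, by simpa using hxU⟩
    have hc : c + t ≠ 0 := fun h => ht (by rw [Set.mem_singleton_iff]; linear_combination h)
    have hf : x + t • e (j₀, k₀) - (c + t) • e (j₀, k₀) ∈
        Submodule.span ℂ (e '' offBlock j₀ k₀ k₀) := by
      convert hz using 1
      rw [hxz, add_smul]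
      abel
    refine ⟨_, htU, exists_pow_apply_eq_zero_of_mem_span hB0 hB (Submodule.add_mem _ hxE
      (Submodule.smul_mem _ _ (Submodule.subset_span ⟨_, rfl⟩))), fun g hg => ?_⟩
    exact exists_aeval_sub_mem_span_offBlock hB0 hB h0
      (fun k hk hz => hk.ne (hne j₀ k hz).2) hc hf (k₀ + 1) le_rfl g (hspan ▸ hg)

end WeightedShift

/-- A bounded weighted backward shift `B` with nonnegative bounded weights `w_{j,k}` with
respect to an orthonormal basis `{e_{j,k} : j ∈ J, k ∈ ℤ₊}` (with `J` countable nonempty) is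
cyclic if and only if at most one of the weights is zero. -/
theorem stmt_13 {H : Type*} [NormedAddCommGroup H] [InnerProductSpace ℂ H] [CompleteSpace H]
    {J : Type*} [Countable J] [Nonempty J]
    (e : HilbertBasis (J × ℕ) ℂ H)
    (w : J → ℕ → ℝ) (hw : ∀ j k, 0 ≤ w j k) (hwbdd : ∃ C : ℝ, ∀ j k, w j k ≤ C)
    (B : H →L[ℂ] H)
    (hB0 : ∀ j : J, B (e (j, 0)) = 0)
    (hB : ∀ (j : J) (k : ℕ), B (e (j, k + 1)) = ((w j k : ℝ) : ℂ) • e (j, k)) :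
    (∃ f, IsCyclicVector B f) ↔ {p : J × ℕ | w p.1 p.2 = 0}.Subsingleton := by
  refine ⟨fun ⟨f, hf⟩ => hf.subsingleton_zero_weights hB0 hB, fun hZ => ?_⟩
  by_cases h : ∃ j k, w j k = 0
  · obtain ⟨j₀, k₀, h0⟩ := h
    refine exists_isCyclicVector_of_unique_zero_weight hB0 hB h0 fun j k hjk => ?_
    simpa using hZ (show (j, k) ∈ _ from hjk) (show (j₀, k₀) ∈ _ from h0)
  · push Not at h
    exact exists_isCyclicVector_of_weights_ne_zero hB0 hB h
end

section
/- Let k₀ ∈ ℕ and let 𝒯 = (V, E) be the directed tree with vertex set V = ℤ ∪ {1', 2', …, k₀'} and edge set E = {(n, n+1) : n ∈ ℤ} ∪ {(0, 1')} ∪ {(k', (k+1)') : 1 ≤ k < k₀} (so 𝒯 is rootless, Br(𝒯) = 1, and k₀' is the unique leaf). Let S_λ be a bounded weighted shift on 𝒯 with strictly positive weights {λ_v : v ∈ V}, and let W be the weighted bilateral shift on ℓ²(ℤ) defined by W e_n = λ_{n+1} e_{n+1} for n ∈ ℤ. Then S_λ is cyclic if and only if W is cyclic. In particular, if S_λ is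 a contraction not of class C_{·0}, then S_λ is cyclic. -/
open Filter Topology

/-- The edge relation of the directed tree with vertex set `ℤ ∪ {1', 2', …, k₀'}`, where the
primed vertex `(j+1)'` is represented by `Sum.inr j` for `j : Fin k₀`: edges are
`(n, n+1)` for `n ∈ ℤ`, `(0, 1')`, and `(k', (k+1)')` for `1 ≤ k < k₀`. -/
def treeE (k₀ : ℕ) : ℤ ⊕ Fin k₀ → ℤ ⊕ Fin k₀ → Prop
  | Sum.inl m, Sum.inl n => n = m + 1
  | Sum.inl m, Sum.inr j => m = 0 ∧ (j : ℕ) = 0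
  | Sum.inr i, Sum.inr j => (j : ℕ) = (i : ℕ) + 1
  | Sum.inr _, Sum.inl _ => False

theorem norm_fourier_apply {T : ℝ} (n : ℤ) (x : AddCircle T) : ‖(fourier n x : ℂ)‖ = 1 := by
  rw [fourier_apply, Circle.norm_coe]

open MeasureTheory AddCircle in
/-- If the moments of an integrable `G` against all `fourier (-(n + 1))` vanish, then `∫ φ * G = 0`
for every `φ` in the closed nonunital algebra generated by `fourier (-1)`. -/
theorem integral_mul_eq_zero_of_mem_closure_adjoin {G : UnitAddCircle → ℂ}
    (hG : Integrable G haarAddCircle)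
    (h : ∀ n : ℕ, ∫ x, fourier (-((n : ℤ) + 1)) x * G x ∂haarAddCircle = 0)
    {φ : C(UnitAddCircle, ℂ)}
    (hφ : φ ∈ (NonUnitalAlgebra.adjoin ℂ
      {(fourier (-1) : C(UnitAddCircle, ℂ))}).topologicalClosure) :
    ∫ x, φ x * G x ∂haarAddCircle = 0 := by
  have hψG : ∀ ψ : C(UnitAddCircle, ℂ), Integrable (fun x => ψ x * G x) haarAddCircle := fun ψ =>
    hG.bdd_mul ψ.continuous.aestronglyMeasurable (Eventually.of_forall ψ.norm_coe_le_norm)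
  let L : C(UnitAddCircle, ℂ) →L[ℂ] ℂ := LinearMap.mkContinuous
    { toFun := fun ψ => ∫ x, ψ x * G x ∂haarAddCircle
      map_add' := fun ψ χ => by
        rw [← integral_add (hψG ψ) (hψG χ)]
        simp [add_mul]
      map_smul' := fun c ψ => by
        simp [mul_assoc, integral_const_mul] }
    (∫ x, ‖G x‖ ∂haarAddCircle) (fun ψ => by
      refine (norm_integral_le_integral_norm _).trans ?_
      rw [mul_comm, ← integral_const_mul]
      refine integral_mono (hψG ψ).norm (hG.norm.const_mul _) fun x => ?_
      simp only [norm_mul]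
      gcongr
      exact ψ.norm_coe_le_norm x)
  have hmono : ∀ ψ ∈ Subsemigroup.closure {(fourier (-1) : C(UnitAddCircle, ℂ))},
      ∃ n : ℕ, ψ = fourier (-((n : ℤ) + 1)) := by
    intro ψ hψ
    induction hψ using Subsemigroup.closure_induction with
    | mem x hx => exact ⟨0, by simpa using hx⟩
    | mul x y _ _ hx hy =>
      obtain ⟨n, rfl⟩ := hx
      obtain ⟨m, rfl⟩ := hy
      refine ⟨n + m + 1, ?_⟩
      ext t
      rw [ContinuousMap.mul_apply, ← fourier_add]
      grind
  have hadj : ∀ ψ ∈ NonUnitalAlgebra.adjoin ℂ {(fourier (-1) : C(UnitAddCircle, ℂ))}, L ψ = 0 := by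
    intro ψ hψ
    rw [← NonUnitalSubalgebra.mem_toSubmodule, NonUnitalAlgebra.adjoin_eq_span] at hψ
    refine (Submodule.span_le (p := L.ker)).2 ?_ hψ
    intro χ hχ
    obtain ⟨n, rfl⟩ := hmono χ hχ
    exact h n
  exact closure_minimal (t := {ψ | L ψ = 0}) hadj (isClosed_eq L.continuous continuous_const) hφ

open Complex in
theorem re_div_one_sub_of_norm_eq_one {w : ℂ} (hw : ‖w‖ = 1) (hw1 : w ≠ 1) :
    (w / (1 - w)).re = -(1 / 2) := by
  have h1 : 1 - w ≠ 0 := sub_ne_zero.2 hw1.symm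
  have hn : w.re * w.re + w.im * w.im = 1 := by
    have := Complex.normSq_eq_norm_sq w
    rw [hw, Complex.normSq_apply] at this
    simpa using this
  have h2 : normSq (1 - w) ≠ 0 := (normSq_pos.2 h1).ne'
  rw [div_re, ← add_div, div_eq_iff h2, normSq_apply]
  simp only [sub_re, one_re, sub_im, one_im]
  linear_combination (-1 / 2 : ℝ) * hn

/-- A bounded weight on the circle vanishing rapidly at `0`. -/
noncomputable def circleWeight (x : UnitAddCircle) : ℝ :=
  Real.exp (-(‖1 - fourier (-1) x‖ ^ 2)⁻¹)

theorem circleWeight_pos (x : UnitAddCircle) : 0 < circleWeight x := Real.exp_pos _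

theorem circleWeight_le_one (x : UnitAddCircle) : circleWeight x ≤ 1 :=
  Real.exp_le_one_iff.2 (neg_nonpos.2 (by positivity))

theorem measurable_circleWeight : Measurable circleWeight := by
  unfold circleWeight
  have : Measurable fun x : UnitAddCircle => (fourier (-1) x : ℂ) :=
    (fourier (-1)).continuous.measurable
  fun_prop

theorem norm_one_sub_le_two_mul {w : ℂ} (hw : ‖w‖ = 1) {r : ℝ} (hr : 0 ≤ r) (hr1 : r < 1) :
    ‖1 - w‖ ≤ 2 * ‖1 - r * w‖ := by
  have hrw : ‖(r : ℂ) * w‖ = r := by simp [hw, abs_of_nonneg hr]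
  have h1 : 1 - r ≤ ‖1 - r * w‖ := by
    have := norm_sub_norm_le (1 : ℂ) (r * w)
    rwa [hrw, norm_one] at this
  have h2 : ‖1 - w‖ ≤ ‖1 - r * w‖ + (1 - r) := by
    have h3 : 1 - w = (1 - r * w) + -(((1 - r : ℝ) : ℂ) * w) := by push_cast; ring
    have h4 : ‖-(((1 - r : ℝ) : ℂ) * w)‖ = 1 - r := by
      rw [norm_neg, norm_mul, hw, Complex.norm_real, Real.norm_eq_abs,
        abs_of_nonneg (by linarith), mul_one]
    calc ‖1 - w‖ ≤ ‖1 - r * w‖ + ‖-(((1 - r : ℝ) : ℂ) * w)‖ := by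
          conv_lhs => rw [h3]
          exact norm_add_le _ _
      _ = _ := by rw [h4]
  linarith

theorem norm_exp_mul_circleWeight_le {c r : ℝ} (hc : 0 ≤ c) (hr : 0 ≤ r) (hr1 : r < 1)
    {x : UnitAddCircle} (hx : (fourier (-1) x : ℂ) ≠ 1) :
    ‖Complex.exp (c * (r * fourier (-1) x / (1 - r * fourier (-1) x)))‖ * circleWeight x ≤
      Real.exp (c ^ 2) := by
  have hw : ‖(fourier (-1) x : ℂ)‖ = 1 := norm_fourier_apply _ _
  rw [Complex.norm_exp, circleWeight, ← Real.exp_add, Real.exp_le_exp, Complex.re_ofReal_mul]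
  set w : ℂ := fourier (-1) x
  have hpos : 0 < ‖1 - w‖ := norm_pos_iff.2 (sub_ne_zero.2 hx.symm)
  have h2 := norm_one_sub_le_two_mul hw hr hr1
  have h3 : (r * w / (1 - r * w)).re ≤ 2 * ‖1 - w‖⁻¹ := by
    refine (Complex.re_le_norm _).trans ?_
    rw [norm_div, norm_mul, hw, Complex.norm_real, Real.norm_eq_abs, abs_of_nonneg hr, mul_one,
      ← div_eq_mul_inv, div_le_div_iff₀ (by linarith) hpos]
    nlinarith
  have h4 := mul_le_mul_of_nonneg_left h3 hc
  rw [← inv_pow]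
  nlinarith [sq_nonneg (c - ‖1 - w‖⁻¹)]

/-- The kernel `r w / (1 - r w)`, `w = fourier (-1)`, as an element of the closed nonunital algebra
generated by `w`. -/
theorem exists_mem_closure_adjoin_eq_exp (c : ℝ) {r : ℝ} (hr : 0 ≤ r) (hr1 : r < 1) :
    ∃ φ ∈ (NonUnitalAlgebra.adjoin ℂ
      {(fourier (-1) : C(UnitAddCircle, ℂ))}).topologicalClosure,
      ∀ x, φ x = Complex.exp (c * (r * fourier (-1) x / (1 - r * fourier (-1) x))) - 1 := by
  set A := (NonUnitalAlgebra.adjoin ℂ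
      {(fourier (-1) : C(UnitAddCircle, ℂ))}).topologicalClosure with hA
  have hAc : IsClosed (A : Set C(UnitAddCircle, ℂ)) :=
    NonUnitalSubalgebra.isClosed_topologicalClosure _
  have hpow : ∀ a ∈ A, ∀ n : ℕ, a ^ (n + 1) ∈ A := by
    intro a ha n
    induction n with
    | zero => simpa using ha
    | succ n ih => rw [pow_succ]; exact mul_mem ih ha
  have hw : (r : ℂ) • (fourier (-1) : C(UnitAddCircle, ℂ)) ∈ A :=
    SMulMemClass.smul_mem _ (NonUnitalSubalgebra.le_topologicalClosure _
      (NonUnitalAlgebra.subset_adjoin ℂ rfl))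
  have hnorm : ‖(r : ℂ) • (fourier (-1) : C(UnitAddCircle, ℂ))‖ < 1 := by
    rw [norm_smul, fourier_norm]
    simpa [abs_of_nonneg hr] using hr1
  set v := (r : ℂ) • (fourier (-1) : C(UnitAddCircle, ℂ)) with hv
  set ψ : C(UnitAddCircle, ℂ) := ∑' n : ℕ, v ^ (n + 1) with hψ
  have hψA : ψ ∈ A := tsum_mem hAc (hpow v hw)
  have hsum : Summable fun n : ℕ => v ^ (n + 1) :=
    (summable_nat_add_iff 1).2 (summable_geometric_of_norm_lt_one hnorm)
  have hψx : ∀ x, ψ x = r * fourier (-1) x / (1 - r * fourier (-1) x) := by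
    intro x
    rw [hψ, ← ContinuousMap.tsum_apply hsum x]
    have hvx : v x = r * fourier (-1) x := by simp [hv]
    have hvn : ‖v x‖ < 1 := (v.norm_coe_le_norm x).trans_lt hnorm
    simp only [pow_succ', ContinuousMap.mul_apply, ContinuousMap.pow_apply]
    rw [tsum_mul_left, tsum_geometric_of_norm_lt_one hvn, hvx, div_eq_mul_inv]
  have hexp := NormedSpace.exp_series_hasSum_exp' (𝕂 := ℂ) ((c : ℂ) • ψ)
  have hexp' := (hasSum_nat_add_iff' 1).2 hexp
  refine ⟨NormedSpace.exp ((c : ℂ) • ψ) - 1, ?_, ?_⟩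
  · have : NormedSpace.exp ((c : ℂ) • ψ) - 1 =
        ∑' n : ℕ, (((n + 1).factorial : ℂ)⁻¹) • ((c : ℂ) • ψ) ^ (n + 1) := by
      rw [hexp'.tsum_eq]
      simp
    rw [this]
    exact tsum_mem hAc fun n => SMulMemClass.smul_mem _ (hpow _ (SMulMemClass.smul_mem _ hψA) n)
  · intro x
    rw [NormedSpace.exp_continuousMap_eq]
    simp [hψx, Complex.exp_eq_exp_ℂ]

open MeasureTheory AddCircle in
theorem ae_fourier_neg_one_ne_one :
    ∀ᵐ x : UnitAddCircle ∂haarAddCircle, (fourier (-1) x : ℂ) ≠ 1 := by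
  have : Nontrivial UnitAddCircle := by
    have : Nontrivial (Set.Ico (0 : ℝ) (0 + 1)) :=
      ⟨⟨0, by norm_num⟩, ⟨1 / 2, by norm_num⟩, by simp [Subtype.ext_iff]⟩
    exact (AddCircle.equivIco (1 : ℝ) 0).nontrivial
  filter_upwards [compl_mem_ae_iff.2 (measure_singleton (μ := haarAddCircle) (0 : UnitAddCircle))]
    with x hx h
  apply hx
  apply AddCircle.injective_toCircle (T := 1) one_ne_zero
  rw [fourier_neg, fourier_one] at h
  have := congrArg (starRingEnd ℂ) h
  ext
  simpa using this

open MeasureTheory AddCircle in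
theorem integral_circleWeight_mul_eq_zero {g : UnitAddCircle → ℂ}
    (hg : Integrable g haarAddCircle)
    (h : ∀ n : ℕ, ∫ x, fourier (-((n : ℤ) + 1)) x * (circleWeight x * g x) ∂haarAddCircle = 0) :
    ∫ x, circleWeight x * g x ∂haarAddCircle = 0 := by
  have hωm : AEStronglyMeasurable (fun x => (circleWeight x : ℂ)) haarAddCircle :=
    (Complex.measurable_ofReal.comp measurable_circleWeight).aestronglyMeasurable
  have hG : Integrable (fun x => circleWeight x * g x) haarAddCircle :=
    hg.bdd_mul (c := 1) hωm (Eventually.of_forall fun x => by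
        simpa [abs_of_pos (circleWeight_pos x)] using circleWeight_le_one x)
  have hkey : ∀ c : ℝ, 0 ≤ c → ∀ r : ℝ, 0 ≤ r → r < 1 →
      ∫ x, Complex.exp (c * (r * fourier (-1) x / (1 - r * fourier (-1) x))) *
        (circleWeight x * g x) ∂haarAddCircle = ∫ x, circleWeight x * g x ∂haarAddCircle := by
    intro c hc r hr hr1
    obtain ⟨φ, hφ, hφx⟩ := exists_mem_closure_adjoin_eq_exp c hr hr1
    have h0 := integral_mul_eq_zero_of_mem_closure_adjoin hG h hφ
    have hφi : Integrable (fun x => φ x * (circleWeight x * g x)) haarAddCircle :=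
      hG.bdd_mul φ.continuous.aestronglyMeasurable (Eventually.of_forall φ.norm_coe_le_norm)
    rw [← zero_add (∫ x, circleWeight x * g x ∂haarAddCircle), ← h0, ← integral_add hφi hG]
    refine integral_congr_ae (Eventually.of_forall fun x => ?_)
    simp only [hφx]
    ring
  have hbound : ∀ c : ℝ, 0 ≤ c → ‖∫ x, circleWeight x * g x ∂haarAddCircle‖ ≤
      Real.exp (-(c / 2)) * ∫ x, ‖(circleWeight x * g x : ℂ)‖ ∂haarAddCircle := by
    intro c hc
    set r : ℕ → ℝ := fun n => 1 - 1 / ((n : ℝ) + 1) with hrdef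
    have hr0 : ∀ n, 0 ≤ r n := fun n => by
      rw [hrdef, sub_nonneg, div_le_one (by positivity)]; linarith [n.cast_nonneg (α := ℝ)]
    have hr1 : ∀ n, r n < 1 := fun n => by
      simp only [hrdef]; linarith [Nat.one_div_pos_of_nat (α := ℝ) (n := n)]
    have hrlim : Tendsto r atTop (𝓝 1) := by
      simpa [hrdef] using (tendsto_one_div_add_atTop_nhds_zero_nat (𝕜 := ℝ)).const_sub 1
    have hlim := tendsto_integral_of_dominated_convergence (μ := haarAddCircle)
      (F := fun n x => Complex.exp (c * (r n * fourier (-1) x / (1 - r n * fourier (-1) x))) *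
        (circleWeight x * g x))
      (f := fun x => Complex.exp (c * (fourier (-1) x / (1 - fourier (-1) x))) *
        (circleWeight x * g x)) (fun x => Real.exp (c ^ 2) * ‖g x‖) ?_
      (hg.norm.const_mul _) ?_ ?_
    · have hconst := hlim.congr fun n => hkey c hc (r n) (hr0 n) (hr1 n)
      rw [tendsto_const_nhds_iff] at hconst
      rw [hconst, ← integral_const_mul]
      refine (norm_integral_le_integral_norm _).trans_eq (integral_congr_ae ?_)
      filter_upwards [ae_fourier_neg_one_ne_one] with x hx
      have hw : ‖(fourier (-1) x : ℂ)‖ = 1 := norm_fourier_apply _ _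
      rw [norm_mul, Complex.norm_exp, Complex.re_ofReal_mul,
        re_div_one_sub_of_norm_eq_one hw hx]
      congr 2
      ring
    · intro n
      obtain ⟨φ, -, hφx⟩ := exists_mem_closure_adjoin_eq_exp c (hr0 n) (hr1 n)
      have : (fun x => Complex.exp (c * (r n * fourier (-1) x / (1 - r n * fourier (-1) x)))) =
          fun x => φ x + 1 := by
        funext x; rw [hφx]; ring
      refine AEStronglyMeasurable.mul ?_ hG.aestronglyMeasurable
      rw [this]
      exact (φ.continuous.add continuous_const).aestronglyMeasurable
    · intro n
      filter_upwards [ae_fourier_neg_one_ne_one] with x hx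
      rw [norm_mul, norm_mul, ← mul_assoc, Complex.norm_real, Real.norm_eq_abs,
        abs_of_pos (circleWeight_pos x)]
      gcongr
      exact norm_exp_mul_circleWeight_le hc (hr0 n) (hr1 n) hx
    · filter_upwards [ae_fourier_neg_one_ne_one] with x hx
      have hrc : Tendsto (fun n => (r n : ℂ)) atTop (𝓝 1) := by
        simpa [Function.comp_def] using (Complex.continuous_ofReal.tendsto 1).comp hrlim
      have hd : (1 - 1 * fourier (-1) x : ℂ) ≠ 0 := by
        rw [one_mul]; exact sub_ne_zero.2 hx.symm
      have hq := (hrc.mul_const (fourier (-1) x : ℂ)).div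
        ((hrc.mul_const (fourier (-1) x : ℂ)).const_sub 1) hd
      rw [one_mul] at hq
      exact ((Complex.continuous_exp.tendsto _).comp (hq.const_mul (c : ℂ))).mul_const _
  have hto : Tendsto (fun c : ℝ => Real.exp (-(c / 2)) *
      ∫ x, ‖(circleWeight x * g x : ℂ)‖ ∂haarAddCircle) atTop (𝓝 0) := by
    have h1 : Tendsto (fun c : ℝ => Real.exp (-(c / 2))) atTop (𝓝 0) :=
      Real.tendsto_exp_neg_atTop_nhds_zero.comp (tendsto_id.atTop_div_const two_pos)
    simpa using h1.mul_const _
  refine norm_le_zero_iff.1 (ge_of_tendsto hto ?_)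
  filter_upwards [eventually_ge_atTop 0] with c hc using hbound c hc

open MeasureTheory AddCircle in
/-- An `L²` function orthogonal to all `fourier n * circleWeight`, `n ≥ 0`, vanishes. -/
theorem eq_zero_of_integral_fourier_mul_circleWeight_eq_zero
    (g : Lp ℂ 2 (haarAddCircle : Measure UnitAddCircle))
    (h : ∀ n : ℕ, ∫ x, fourier (-(n : ℤ)) x * (circleWeight x * g x) ∂haarAddCircle = 0) :
    g = 0 := by
  have hgi : Integrable g haarAddCircle := (Lp.memLp g).integrable (by norm_num)
  have hpos : ∀ k : ℕ, ∀ n : ℤ, -(k : ℤ) ≤ n →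
      ∫ x, fourier (-n) x * (circleWeight x * g x) ∂haarAddCircle = 0 := by
    intro k
    induction k with
    | zero =>
      intro n hn
      obtain ⟨m, rfl⟩ := Int.eq_ofNat_of_zero_le (by simpa using hn)
      exact h m
    | succ k ih =>
      intro n hn
      rcases hn.eq_or_lt with rfl | hn
      · have hi : Integrable (fun x => fourier ((k : ℤ) + 1) x * g x) haarAddCircle :=
          hgi.bdd_mul (fourier _).continuous.aestronglyMeasurable
            (Eventually.of_forall (fourier _).norm_coe_le_norm)
        have := integral_circleWeight_mul_eq_zero hi fun n => by
          rw [← ih (n - k) (by omega)]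
          refine integral_congr_ae (Eventually.of_forall fun x => ?_)
          have : -((n : ℤ) - k) = -((n : ℤ) + 1) + (k + 1) := by ring
          simp only [this, fourier_add]
          ring
        rw [← this]
        refine integral_congr_ae (Eventually.of_forall fun x => ?_)
        simp only [Nat.cast_add, Nat.cast_one, neg_neg]
        ring
      · exact ih n (by push_cast at hn; omega)
  have hmem : MemLp (fun x => (circleWeight x : ℂ) * g x) 2 haarAddCircle := by
    refine (Lp.memLp g).of_le ?_ (Eventually.of_forall fun x => ?_)
    · exact (Complex.measurable_ofReal.comp measurable_circleWeight).aestronglyMeasurable.mul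
        (Lp.aestronglyMeasurable g)
    · rw [norm_mul, Complex.norm_real, Real.norm_eq_abs, abs_of_pos (circleWeight_pos x)]
      exact mul_le_of_le_one_left (norm_nonneg _) (circleWeight_le_one x)
  have hzero : hmem.toLp = 0 := by
    refine fourierBasis.repr.injective ?_
    ext n
    rw [fourierBasis_repr, fourierCoeff_congr_ae hmem.coeFn_toLp, fourierCoeff]
    simpa using hpos n.natAbs n (by omega)
  rw [Lp.eq_zero_iff_ae_eq_zero] at hzero ⊢
  filter_upwards [hzero, hmem.coeFn_toLp] with x hx hx'
  rw [hx'] at hx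
  exact (mul_eq_zero.1 hx).resolve_left (by exact_mod_cast (circleWeight_pos x).ne')

open MeasureTheory AddCircle in
/-- The bilateral shift on `ℓ²(ℤ)` has a cyclic vector; here the forward orbit is given by `a`. -/
theorem exists_shift_orbit_total :
    ∃ a : ℕ → lp (fun _ : ℤ => ℂ) 2, (∀ k n, a k n = a 0 (n - k)) ∧
      ∀ b : lp (fun _ : ℤ => ℂ) 2, (∀ k, inner ℂ (a k) b = 0) → b = 0 := by
  have hmem : ∀ k : ℕ, MemLp (fun x => (fourier (k : ℤ) x : ℂ) * circleWeight x) 2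
      (haarAddCircle : Measure UnitAddCircle) := fun k => by
    refine MemLp.of_bound ?_ 1 (Eventually.of_forall fun x => ?_)
    · exact (fourier _).continuous.aestronglyMeasurable.mul
        (Complex.measurable_ofReal.comp measurable_circleWeight).aestronglyMeasurable
    · have hw : ‖(fourier (k : ℤ) x : ℂ)‖ = 1 := norm_fourier_apply _ _
      rw [norm_mul, hw, Complex.norm_real, Real.norm_eq_abs, abs_of_pos (circleWeight_pos x),
        one_mul]
      exact circleWeight_le_one x
  refine ⟨fun k => fourierBasis.repr (hmem k).toLp, fun k n => ?_, fun b hb => ?_⟩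
  · rw [fourierBasis_repr, fourierBasis_repr, fourierCoeff_congr_ae (hmem k).coeFn_toLp,
      fourierCoeff_congr_ae (hmem 0).coeFn_toLp, fourierCoeff, fourierCoeff]
    refine integral_congr_ae (Eventually.of_forall fun x => ?_)
    have : -(n - k : ℤ) = -n + k := by ring
    simp only [this, fourier_add, smul_eq_mul, Nat.cast_zero, fourier_zero]
    ring
  · have hg : (@fourierBasis 1 _).repr.symm b = (0 : Lp ℂ 2
        (haarAddCircle : Measure UnitAddCircle)) := by
      refine eq_zero_of_integral_fourier_mul_circleWeight_eq_zero _ fun k => ?_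
      have h := hb k
      rw [← (@fourierBasis 1 _).repr.apply_symm_apply b, LinearIsometryEquiv.inner_map_map,
        L2.inner_def] at h
      rw [← h]
      refine integral_congr_ae ?_
      filter_upwards [(hmem k).coeFn_toLp] with x hx
      rw [hx, fourier_neg]
      simp only [RCLike.inner_apply, map_mul, Complex.conj_ofReal]
      ring
    simpa using hg

theorem isCyclicVector_iff {H : Type*} [NormedAddCommGroup H] [InnerProductSpace ℂ H]
    [CompleteSpace H] {T : H →L[ℂ] H} {f : H} :
    IsCyclicVector T f ↔ ∀ y : H, (∀ n : ℕ, inner ℂ ((T ^ n) f) y = 0) → y = 0 := by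
  rw [IsCyclicVector, Submodule.topologicalClosure_eq_top_iff, Submodule.eq_bot_iff]
  refine forall_congr' fun y => ?_
  rw [← Submodule.span_singleton_le_iff_mem, ← Submodule.isOrtho_iff_le, Submodule.isOrtho_comm,
    Submodule.isOrtho_span]
  simp

theorem clm_ext_single {ι F : Type*} [DecidableEq ι] [NormedAddCommGroup F] [NormedSpace ℂ F]
    {A B : lp (fun _ : ι => ℂ) 2 →L[ℂ] F}
    (h : ∀ i, A (lp.single 2 i 1) = B (lp.single 2 i 1)) : A = B := by
  refine lp.ext_continuousLinearMap (by simp) fun i => ?_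
  ext
  simpa using h i

theorem apply_eq_of_apply_single {ι κ : Type*} [DecidableEq ι]
    (A : lp (fun _ : ι => ℂ) 2 →L[ℂ] lp (fun _ : κ => ℂ) 2) (k : κ) (i : ι) (c : ℂ)
    (h : ∀ j, A (lp.single 2 j 1) k = c * (lp.single 2 j (1 : ℂ) : lp (fun _ : ι => ℂ) 2) i)
    (x : lp (fun _ : ι => ℂ) 2) : A x k = c * x i := by
  have := clm_ext_single (A := (lp.evalCLM ℂ (fun _ : κ => ℂ) 2 k).comp A)
    (B := c • lp.evalCLM ℂ (fun _ : ι => ℂ) 2 i) h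
  exact DFunLike.congr_fun this x

theorem pow_apply_succ {H : Type*} [NormedAddCommGroup H] [NormedSpace ℂ H] (T : H →L[ℂ] H)
    (n : ℕ) (x : H) : (T ^ (n + 1)) x = T ((T ^ n) x) := by
  rw [pow_succ']; rfl

theorem intertwine_pow {H K : Type*} [NormedAddCommGroup H] [NormedSpace ℂ H]
    [NormedAddCommGroup K] [NormedSpace ℂ K] {T : H →L[ℂ] H} {U : K →L[ℂ] K} {R : H →L[ℂ] K}
    (h : ∀ x, R (T x) = U (R x)) (n : ℕ) (x : H) : R ((T ^ n) x) = (U ^ n) (R x) := by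
  induction n with
  | zero => simp
  | succ n ih => rw [pow_apply_succ, pow_apply_succ, h, ih]

/-- Restriction of square-summable families along an injective map. -/
theorem exists_lp_restrict {ι κ : Type*} {e : κ → ι} (he : Function.Injective e) :
    ∃ P : lp (fun _ : ι => ℂ) 2 →L[ℂ] lp (fun _ : κ => ℂ) 2, ∀ x k, P x k = x (e k) := by
  have h2 : 0 < (2 : ENNReal).toReal := by norm_num
  have hs : ∀ x : lp (fun _ : ι => ℂ) 2, Summable fun i => ‖x i‖ ^ (2 : ENNReal).toReal :=
    fun x => (lp.memℓp x).summable h2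
  let L : lp (fun _ : ι => ℂ) 2 →ₗ[ℂ] lp (fun _ : κ => ℂ) 2 :=
    { toFun := fun x => ⟨fun k => x (e k), memℓp_gen ((hs x).comp_injective he)⟩
      map_add' := fun x y => rfl
      map_smul' := fun c x => rfl }
  refine ⟨L.mkContinuous 1 fun x => ?_, fun x k => rfl⟩
  rw [one_mul]
  refine lp.norm_le_of_tsum_le h2 (norm_nonneg _) ?_
  rw [lp.norm_rpow_eq_tsum h2 x]
  exact tsum_comp_le_tsum_of_inj (hs x) (fun i => by positivity) he

theorem exists_lp_mul {ι : Type*} {x : ι → ℝ} (h0 : ∀ i, 0 ≤ x i) (h1 : ∀ i, x i ≤ 1)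
    (a : lp (fun _ : ι => ℂ) 2) : ∃ d : lp (fun _ : ι => ℂ) 2, ∀ i, d i = x i * a i := by
  have h2 : 0 < (2 : ENNReal).toReal := by norm_num
  refine ⟨⟨fun i => x i * a i, memℓp_gen (((lp.memℓp a).summable h2).of_nonneg_of_le
    (fun i => by positivity) fun i => ?_)⟩, fun i => rfl⟩
  refine Real.rpow_le_rpow (norm_nonneg _) ?_ h2.le
  rw [norm_mul, Complex.norm_real, Real.norm_eq_abs, abs_of_nonneg (h0 i)]
  exact mul_le_of_le_one_left (norm_nonneg _) (h1 i)

/-- A weighted bilateral shift which is a bounded positive diagonal transform of the unweighted one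
has a cyclic vector. -/
theorem exists_isCyclicVector_of_diagonal {w : ℤ → ℝ}
    {W : lp (fun _ : ℤ => ℂ) 2 →L[ℂ] lp (fun _ : ℤ => ℂ) 2}
    (hW : ∀ y n, W y n = w n * y (n - 1)) {x : ℤ → ℝ} (h0 : ∀ n, 0 < x n) (h1 : ∀ n, x n ≤ 1)
    (hx : ∀ n, x n = w n * x (n - 1)) : ∃ g, IsCyclicVector W g := by
  obtain ⟨a, ha, hab⟩ := exists_shift_orbit_total
  obtain ⟨g, hg⟩ := exists_lp_mul (fun n => (h0 n).le) h1 (a 0)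
  have hk : ∀ (k : ℕ) n, (W ^ k) g n = x n * a k n := by
    intro k
    induction k with
    | zero => simpa using hg
    | succ k ih =>
      intro n
      rw [pow_apply_succ, hW, ih, ha k, ha (k + 1), hx n]
      have : n - 1 - (k : ℤ) = n - ((k + 1 : ℕ) : ℤ) := by push_cast; ring
      rw [this]
      push_cast
      ring
  refine ⟨g, isCyclicVector_iff.2 fun y hy => ?_⟩
  obtain ⟨d, hd⟩ := exists_lp_mul (fun n => (h0 n).le) h1 y
  have hd0 : d = 0 := hab d fun k => by
    rw [← hy k, lp.inner_eq_tsum, lp.inner_eq_tsum]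
    refine tsum_congr fun n => ?_
    rw [hk, hd]
    simp only [RCLike.inner_apply, map_mul, Complex.conj_ofReal]
    ring
  ext n
  have := hd n
  rw [hd0] at this
  simpa [(h0 n).ne'] using this.symm

/-- The parent of a vertex in the directed tree given by `treeE`. -/
def treeParent (k₀ : ℕ) : ℤ ⊕ Fin k₀ → ℤ ⊕ Fin k₀
  | Sum.inl n => Sum.inl (n - 1)
  | Sum.inr ⟨0, _⟩ => Sum.inl 0
  | Sum.inr ⟨j + 1, h⟩ => Sum.inr ⟨j, by omega⟩

theorem treeE_iff_eq_treeParent {k₀ : ℕ} (u v : ℤ ⊕ Fin k₀) :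
    treeE k₀ u v ↔ u = treeParent k₀ v := by
  rcases u with m | ⟨i, hi⟩ <;> rcases v with n | ⟨_ | j, hj⟩ <;> simp [treeE, treeParent] <;> omega

theorem treeShift_apply {k₀ : ℕ} {lam : ℤ ⊕ Fin k₀ → ℝ}
    {S : lp (fun _ : ℤ ⊕ Fin k₀ => ℂ) 2 →L[ℂ] lp (fun _ : ℤ ⊕ Fin k₀ => ℂ) 2}
    (hS : ∀ u v : ℤ ⊕ Fin k₀, (S (lp.single 2 u (1 : ℂ))) v =
      Set.indicator {w | treeE k₀ u w} (fun w => (lam w : ℂ)) v)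
    (x : lp (fun _ : ℤ ⊕ Fin k₀ => ℂ) 2) (v : ℤ ⊕ Fin k₀) :
    S x v = lam v * x (treeParent k₀ v) := by
  refine apply_eq_of_apply_single S v _ _ (fun u => ?_) x
  classical
  rw [hS, lp.single_apply, Pi.single_apply, Set.indicator_apply]
  simp only [Set.mem_ofPred_eq, treeE_iff_eq_treeParent, eq_comm (a := u)]
  split_ifs <;> simp

theorem bilateralShift_apply {w : ℤ → ℝ}
    {W : lp (fun _ : ℤ => ℂ) 2 →L[ℂ] lp (fun _ : ℤ => ℂ) 2}
    (hW : ∀ n : ℤ, W (lp.single 2 n (1 : ℂ)) = (w (n + 1) : ℂ) • lp.single 2 (n + 1) (1 : ℂ))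
    (y : lp (fun _ : ℤ => ℂ) 2) (n : ℤ) : W y n = w n * y (n - 1) := by
  refine apply_eq_of_apply_single W n _ _ (fun m => ?_) y
  rw [hW, lp.coeFn_smul, Pi.smul_apply, lp.single_apply, lp.single_apply, Pi.single_apply,
    Pi.single_apply]
  by_cases h : n = m + 1
  · subst h; simp
  · rw [if_neg h, if_neg (by omega)]; simp

theorem inner_single_one_left {ι : Type*} [DecidableEq ι] (i : ι) (x : lp (fun _ : ι => ℂ) 2) :
    inner ℂ (lp.single 2 i (1 : ℂ)) x = x i := by
  simp [lp.inner_single_left]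

theorem adjoint_restrict_inl_apply {κ μ : Type*} [DecidableEq κ] [DecidableEq μ]
    {P : lp (fun _ : κ ⊕ μ => ℂ) 2 →L[ℂ] lp (fun _ : κ => ℂ) 2}
    (hP : ∀ x k, P x k = x (Sum.inl k)) (b : lp (fun _ : κ => ℂ) 2) (v : κ ⊕ μ) :
    P.adjoint b v = Sum.elim b (fun _ => 0) v := by
  rw [← inner_single_one_left v, ContinuousLinearMap.adjoint_inner_right]
  rcases v with n | j
  · have : P (lp.single 2 (Sum.inl n) 1) = lp.single 2 n 1 := by
      ext m
      rw [hP]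
      simp [Pi.single_apply]
    rw [this, inner_single_one_left, Sum.elim_inl]
  · have : P (lp.single 2 (Sum.inr j) 1) = 0 := by
      ext m
      rw [hP]
      simp
    rw [this, inner_zero_left, Sum.elim_inr]

/-- The shift on the tree is an extension of the bilateral shift by a nilpotent part, and the
graph-type map `R` splits this extension. -/
theorem exists_intertwiner {k₀ : ℕ} {lam : ℤ ⊕ Fin k₀ → ℝ} (hlam : ∀ v, 0 < lam v)
    {S : lp (fun _ : ℤ ⊕ Fin k₀ => ℂ) 2 →L[ℂ] lp (fun _ : ℤ ⊕ Fin k₀ => ℂ) 2}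
    (hS : ∀ x v, S x v = lam v * x (treeParent k₀ v))
    {W : lp (fun _ : ℤ => ℂ) 2 →L[ℂ] lp (fun _ : ℤ => ℂ) 2}
    (hW : ∀ y n, W y n = lam (Sum.inl n) * y (n - 1)) :
    ∃ R : lp (fun _ : ℤ => ℂ) 2 →L[ℂ] lp (fun _ : ℤ ⊕ Fin k₀ => ℂ) 2,
      (∀ b n, R b (Sum.inl n) = b n) ∧ ∀ b, R (W b) = S (R b) := by
  obtain ⟨P, hP⟩ := exists_lp_restrict (Sum.inl_injective (α := ℤ) (β := Fin k₀))
  have hJ := adjoint_restrict_inl_apply hP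
  let c : ℕ → ℂ := fun n => ∏ i ∈ Finset.range (n + 1),
    ((if h : i < k₀ then lam (Sum.inr ⟨i, h⟩) else 1 : ℝ) : ℂ) / lam (Sum.inl (i + 1))
  let Q : lp (fun _ : ℤ => ℂ) 2 →L[ℂ] lp (fun _ : ℤ ⊕ Fin k₀ => ℂ) 2 :=
    ∑ j : Fin k₀, (lp.evalCLM ℂ (fun _ : ℤ => ℂ) 2 ((j : ℤ) + 1)).smulRight
      (c j • lp.single 2 (Sum.inr j) (1 : ℂ))
  have hQ : ∀ b v, Q b v = Sum.elim (fun _ => 0) (fun j : Fin k₀ => c j * b ((j : ℤ) + 1)) v := by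
    intro b v
    have : Q b = ∑ j : Fin k₀, b ((j : ℤ) + 1) • c j • lp.single 2 (Sum.inr j) (1 : ℂ) := by
      simp only [Q, sum_apply]
      rfl
    rw [this, lp.coeFn_sum, Finset.sum_apply]
    rcases v with n | j
    · simp
    · simp [Pi.single_apply, mul_comm]
  refine ⟨P.adjoint + Q, fun b n => ?_, fun b => ?_⟩
  · simp [hJ, hQ]
  · have hR : ∀ b v, (P.adjoint + Q) b v =
        Sum.elim b (fun j : Fin k₀ => c j * b ((j : ℤ) + 1)) v := by
      intro b v
      rw [add_apply, lp.coeFn_add, Pi.add_apply, hJ, hQ]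
      rcases v with n | j <;> simp
    have hne : ∀ n : ℤ, (lam (Sum.inl n) : ℂ) ≠ 0 := fun n => by exact_mod_cast (hlam _).ne'
    ext v
    rw [hS, hR, hR]
    rcases v with n | ⟨_ | j, hj⟩
    · simp [treeParent, hW]
    · have := hne 1
      simp [treeParent, hW, c, hj]
      field_simp
    · have := hne (j + 1 + 1)
      have hc : c (j + 1) = c j * (lam (Sum.inr ⟨j + 1, hj⟩) / lam (Sum.inl (j + 1 + 1))) := by
        simp only [c]
        rw [Finset.prod_range_succ, dif_pos hj]
        push_cast
        rfl
      simp only [treeParent, Sum.elim_inr, hW, hc]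
      push_cast
      rw [add_sub_cancel_right]
      field_simp

theorem eq_zero_of_inner_pow_bilateralShift {w : ℤ → ℝ} (hw : ∀ n, 0 < w n)
    {W : lp (fun _ : ℤ => ℂ) 2 →L[ℂ] lp (fun _ : ℤ => ℂ) 2}
    (hW : ∀ n : ℤ, W (lp.single 2 n (1 : ℂ)) = (w (n + 1) : ℂ) • lp.single 2 (n + 1) (1 : ℂ))
    (k : ℕ) (z : lp (fun _ : ℤ => ℂ) 2) (hz : ∀ b, inner ℂ ((W ^ k) b) z = 0) : z = 0 := by
  induction k generalizing z with
  | zero => exact inner_self_eq_zero.1 (hz z)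
  | succ k ih =>
    have h1 : W.adjoint z = 0 := ih _ fun b => by
      rw [ContinuousLinearMap.adjoint_inner_right, ← pow_apply_succ]
      exact hz b
    ext n
    have h2 : inner ℂ (W (lp.single 2 (n - 1) (1 : ℂ))) z = 0 := by
      rw [← ContinuousLinearMap.adjoint_inner_right, h1, inner_zero_right]
    rw [hW, inner_smul_left, inner_single_one_left, sub_add_cancel] at h2
    simpa [(hw n).ne'] using h2

theorem treeShift_pow_single_inr {k₀ : ℕ} {lam : ℤ ⊕ Fin k₀ → ℝ} (hlam : ∀ v, 0 < lam v)
    {S : lp (fun _ : ℤ ⊕ Fin k₀ => ℂ) 2 →L[ℂ] lp (fun _ : ℤ ⊕ Fin k₀ => ℂ) 2}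
    (hS : ∀ x v, S x v = lam v * x (treeParent k₀ v)) (hk : 0 < k₀) (n : ℕ) (hn : n < k₀) :
    ∃ c : ℂ, c ≠ 0 ∧
      (S ^ n) (lp.single 2 (Sum.inr ⟨0, hk⟩) 1) = c • lp.single 2 (Sum.inr ⟨n, hn⟩) 1 := by
  induction n with
  | zero => exact ⟨1, one_ne_zero, by simp⟩
  | succ n ih =>
    obtain ⟨c, hc, h⟩ := ih (by omega)
    refine ⟨c * lam (Sum.inr ⟨n + 1, hn⟩),
      mul_ne_zero hc (by exact_mod_cast (hlam _).ne'), ?_⟩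
    rw [pow_apply_succ, h]
    ext v
    rw [map_smul, lp.coeFn_smul, lp.coeFn_smul, Pi.smul_apply, Pi.smul_apply, hS]
    rcases v with m | ⟨_ | j, hj⟩
    · simp [treeParent]
    · simp [treeParent]
    · by_cases hjn : j = n
      · subst hjn; simp [treeParent]
      · simp [treeParent, hjn]

theorem treeShift_pow_single_inr_eq_zero {k₀ : ℕ} {lam : ℤ ⊕ Fin k₀ → ℝ} (hlam : ∀ v, 0 < lam v)
    {S : lp (fun _ : ℤ ⊕ Fin k₀ => ℂ) 2 →L[ℂ] lp (fun _ : ℤ ⊕ Fin k₀ => ℂ) 2}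
    (hS : ∀ x v, S x v = lam v * x (treeParent k₀ v)) (hk : 0 < k₀) (n : ℕ) :
    (S ^ (n + k₀)) (lp.single 2 (Sum.inr ⟨0, hk⟩) 1) = 0 := by
  induction n with
  | zero =>
    obtain ⟨m, rfl⟩ : ∃ m, k₀ = m + 1 := ⟨k₀ - 1, by omega⟩
    obtain ⟨c, -, h⟩ := treeShift_pow_single_inr hlam hS hk m (by omega)
    rw [zero_add, pow_apply_succ, h, map_smul]
    convert smul_zero c
    ext v
    rw [hS]
    rcases v with p | ⟨_ | j, hj⟩
    · simp [treeParent]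
    · rw [show treeParent (m + 1) (Sum.inr ⟨0, hj⟩) = Sum.inl 0 from rfl]
      simp
    · have : j ≠ m := by omega
      simp [treeParent, this]
  | succ n ih => rw [add_right_comm, pow_apply_succ, ih, map_zero]

theorem exists_isCyclicVector_treeShift_iff {k₀ : ℕ} (hk : 0 < k₀) {lam : ℤ ⊕ Fin k₀ → ℝ}
    (hlam : ∀ v, 0 < lam v)
    {S : lp (fun _ : ℤ ⊕ Fin k₀ => ℂ) 2 →L[ℂ] lp (fun _ : ℤ ⊕ Fin k₀ => ℂ) 2}
    (hS : ∀ x v, S x v = lam v * x (treeParent k₀ v))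
    {W : lp (fun _ : ℤ => ℂ) 2 →L[ℂ] lp (fun _ : ℤ => ℂ) 2}
    (hW : ∀ n : ℤ, W (lp.single 2 n (1 : ℂ)) =
      (lam (Sum.inl (n + 1)) : ℂ) • lp.single 2 (n + 1) (1 : ℂ)) :
    (∃ f, IsCyclicVector S f) ↔ ∃ g, IsCyclicVector W g := by
  have hW' := bilateralShift_apply (w := fun n => lam (Sum.inl n)) hW
  obtain ⟨P, hP⟩ := exists_lp_restrict (Sum.inl_injective (α := ℤ) (β := Fin k₀))
  obtain ⟨R, hRl, hR⟩ := exists_intertwiner hlam hS hW'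
  have hPR : ∀ b, P (R b) = b := fun b => by ext n; rw [hP, hRl]
  have hPS : ∀ x, P (S x) = W (P x) := fun x => by
    ext n
    rw [hP, hS, hW', hP]
    rfl
  constructor
  · rintro ⟨f, hf⟩
    refine ⟨P f, isCyclicVector_iff.2 fun y hy => ?_⟩
    have h0 : P.adjoint y = 0 := isCyclicVector_iff.1 hf _ fun n => by
      rw [ContinuousLinearMap.adjoint_inner_right, intertwine_pow hPS]
      exact hy n
    have h1 : inner ℂ (R y) (P.adjoint y) = 0 := by rw [h0, inner_zero_right]
    rw [ContinuousLinearMap.adjoint_inner_right, hPR] at h1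
    exact inner_self_eq_zero.1 h1
  · rintro ⟨g, hg⟩
    set e : lp (fun _ : ℤ ⊕ Fin k₀ => ℂ) 2 := lp.single 2 (Sum.inr ⟨0, hk⟩) 1 with he
    refine ⟨R g + e, isCyclicVector_iff.2 fun y hy => ?_⟩
    have hRy : R.adjoint y = 0 := by
      refine eq_zero_of_inner_pow_bilateralShift (fun n => hlam (Sum.inl n)) hW k₀ _ ?_
      have h0 : (W ^ k₀).adjoint (R.adjoint y) = 0 := isCyclicVector_iff.1 hg _ fun n => by
        have := hy (k₀ + n)
        rw [map_add, add_comm k₀ n, treeShift_pow_single_inr_eq_zero hlam hS hk, add_zero,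
          ← intertwine_pow hR, add_comm n k₀, pow_add] at this
        rw [ContinuousLinearMap.adjoint_inner_right, ContinuousLinearMap.adjoint_inner_right]
        exact this
      intro b
      rw [← ContinuousLinearMap.adjoint_inner_right, h0, inner_zero_right]
    have hRb : ∀ b, inner ℂ (R b) y = 0 := fun b => by
      rw [← ContinuousLinearMap.adjoint_inner_right, hRy, inner_zero_right]
    have hyr : ∀ j, y (Sum.inr j) = 0 := by
      rintro ⟨n, hn⟩
      have h := hy n
      obtain ⟨c, hc, hcn⟩ := treeShift_pow_single_inr hlam hS hk n hn
      rw [map_add, inner_add_left, ← intertwine_pow hR, hRb, zero_add, hcn, inner_smul_left,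
        inner_single_one_left] at h
      simpa [hc] using h
    have hyP : y = P.adjoint (P y) := by
      ext v
      rw [adjoint_restrict_inl_apply hP]
      rcases v with n | j
      · rw [Sum.elim_inl, hP]
      · exact hyr j
    have hPy : P y = 0 := by
      have := hRb (P y)
      rw [hyP, ContinuousLinearMap.adjoint_inner_right, hPR, ← hyP] at this
      exact inner_self_eq_zero.1 this
    rw [hyP, hPy, map_zero]

theorem adjoint_treeShift_single {k₀ : ℕ} {lam : ℤ ⊕ Fin k₀ → ℝ}
    {S : lp (fun _ : ℤ ⊕ Fin k₀ => ℂ) 2 →L[ℂ] lp (fun _ : ℤ ⊕ Fin k₀ => ℂ) 2}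
    (hS : ∀ x v, S x v = lam v * x (treeParent k₀ v)) (v : ℤ ⊕ Fin k₀) :
    S.adjoint (lp.single 2 v (1 : ℂ)) = (lam v : ℂ) • lp.single 2 (treeParent k₀ v) (1 : ℂ) := by
  refine ext_inner_right ℂ fun x => ?_
  rw [ContinuousLinearMap.adjoint_inner_left, inner_single_one_left, inner_smul_left,
    inner_single_one_left, hS, Complex.conj_ofReal]

theorem adjoint_treeShift_pow_single_inl {k₀ : ℕ} {lam : ℤ ⊕ Fin k₀ → ℝ}
    {S : lp (fun _ : ℤ ⊕ Fin k₀ => ℂ) 2 →L[ℂ] lp (fun _ : ℤ ⊕ Fin k₀ => ℂ) 2}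
    (hS : ∀ x v, S x v = lam v * x (treeParent k₀ v)) (n : ℤ) (k : ℕ) :
    (S.adjoint ^ k) (lp.single 2 (Sum.inl n) (1 : ℂ)) =
      ((∏ i ∈ Finset.range k, lam (Sum.inl (n - i)) : ℝ) : ℂ) •
        lp.single 2 (Sum.inl (n - k)) (1 : ℂ) := by
  induction k with
  | zero => simp
  | succ k ih =>
    have : treeParent k₀ (Sum.inl (n - k)) = Sum.inl (n - (k + 1 : ℕ)) := by
      rw [treeParent]
      congr 1
      push_cast
      ring
    rw [pow_apply_succ, ih, map_smul, adjoint_treeShift_single hS, smul_smul, this,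
      Finset.prod_range_succ]
    push_cast
    rfl

theorem norm_pow_apply_le {H : Type*} [NormedAddCommGroup H] [NormedSpace ℂ H] {T : H →L[ℂ] H}
    (hT : ‖T‖ ≤ 1) (n : ℕ) (x : H) : ‖(T ^ n) x‖ ≤ ‖x‖ := by
  induction n with
  | zero => simp
  | succ n ih =>
    rw [pow_apply_succ]
    exact ((T.le_of_opNorm_le hT _).trans_eq (one_mul _)).trans ih

/-- Powers of a contraction on `ℓ²` tend strongly to zero once they do so on the standard basis. -/
theorem tendsto_norm_pow_apply_of_single {ι : Type*} [DecidableEq ι]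
    {T : lp (fun _ : ι => ℂ) 2 →L[ℂ] lp (fun _ : ι => ℂ) 2} (hT : ‖T‖ ≤ 1)
    (h : ∀ i, Tendsto (fun n : ℕ => ‖(T ^ n) (lp.single 2 i (1 : ℂ))‖) atTop (𝓝 0))
    (x : lp (fun _ : ι => ℂ) 2) : Tendsto (fun n : ℕ => ‖(T ^ n) x‖) atTop (𝓝 0) := by
  have hsum : ∀ s : Finset ι,
      Tendsto (fun n : ℕ => ‖(T ^ n) (∑ i ∈ s, lp.single 2 i (x i))‖) atTop (𝓝 0) := by
    intro s
    have h0 : Tendsto (fun n : ℕ => ∑ i ∈ s, ‖x i‖ * ‖(T ^ n) (lp.single 2 i (1 : ℂ))‖) atTop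
        (𝓝 0) := by
      simpa using tendsto_finsetSum s fun i _ => (h i).const_mul ‖x i‖
    refine squeeze_zero (fun n => norm_nonneg _) (fun n => ?_) h0
    rw [map_sum]
    refine (norm_sum_le _ _).trans (Finset.sum_le_sum fun i _ => ?_)
    rw [← norm_smul, ← map_smul, ← lp.single_smul, smul_eq_mul, mul_one]
  have hx := lp.hasSum_single (p := 2) (by simp) x
  rw [Metric.tendsto_atTop]
  intro ε hε
  obtain ⟨s, hs⟩ := (Metric.tendsto_atTop.1 hx) (ε / 2) (by positivity)
  obtain ⟨N, hN⟩ := (Metric.tendsto_atTop.1 (hsum s)) (ε / 2) (by positivity)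
  refine ⟨N, fun n hn => ?_⟩
  have h1 := hN n hn
  have h2 := hs s le_rfl
  rw [dist_zero_right, norm_norm] at h1 ⊢
  rw [dist_comm, dist_eq_norm] at h2
  have h3 := norm_pow_apply_le hT n (x - ∑ i ∈ s, lp.single 2 i (x i))
  have h4 := norm_add_le ((T ^ n) (x - ∑ i ∈ s, lp.single 2 i (x i)))
    ((T ^ n) (∑ i ∈ s, lp.single 2 i (x i)))
  rw [← map_add, sub_add_cancel] at h4
  linarith

theorem weight_le_one_of_norm_le_one {k₀ : ℕ} {lam : ℤ ⊕ Fin k₀ → ℝ}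
    {S : lp (fun _ : ℤ ⊕ Fin k₀ => ℂ) 2 →L[ℂ] lp (fun _ : ℤ ⊕ Fin k₀ => ℂ) 2}
    (hS : ∀ x v, S x v = lam v * x (treeParent k₀ v)) (h1 : ‖S‖ ≤ 1) (v : ℤ ⊕ Fin k₀) :
    lam v ≤ 1 := by
  have h := lp.norm_apply_le_norm two_ne_zero (S (lp.single 2 (treeParent k₀ v) (1 : ℂ))) v
  have h' := S.le_of_opNorm_le h1 (lp.single 2 (treeParent k₀ v) (1 : ℂ))
  rw [lp.norm_single (by norm_num), norm_one, mul_one] at h'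
  rw [hS, lp.single_apply_self, mul_one, Complex.norm_real, Real.norm_eq_abs] at h
  exact (le_abs_self _).trans (h.trans h')

/-- The backward infinite products of weights in `(0, 1]` converge, and satisfy the recursion of the
products. -/
theorem exists_tendsto_prod_weight {w : ℤ → ℝ} (h0 : ∀ n, 0 < w n) (h1 : ∀ n, w n ≤ 1) :
    ∃ x : ℤ → ℝ, (∀ n, Tendsto (fun k : ℕ => ∏ i ∈ Finset.range k, w (n - i)) atTop (𝓝 (x n))) ∧
      (∀ n, 0 ≤ x n) ∧ (∀ n, x n ≤ 1) ∧ ∀ n, x n = w n * x (n - 1) := by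
  have hpos : ∀ n (k : ℕ), 0 < ∏ i ∈ Finset.range k, w (n - i) := fun n k =>
    Finset.prod_pos fun i _ => h0 _
  have hanti : ∀ n, Antitone fun k : ℕ => ∏ i ∈ Finset.range k, w (n - i) := fun n =>
    antitone_nat_of_succ_le fun k => by
      rw [Finset.prod_range_succ]
      exact mul_le_of_le_one_right (hpos n k).le (h1 _)
  have hbdd : ∀ n, BddBelow (Set.range fun k : ℕ => ∏ i ∈ Finset.range k, w (n - i)) := fun n =>
    ⟨0, by rintro _ ⟨k, rfl⟩; exact (hpos n k).le⟩
  have hlim := fun n => tendsto_atTop_ciInf (hanti n) (hbdd n)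
  refine ⟨_, hlim, fun n => ge_of_tendsto' (hlim n) fun k => (hpos n k).le, fun n =>
    le_of_tendsto' (hlim n) fun k => Finset.prod_le_one (fun i _ => (h0 _).le) fun i _ => h1 _,
    fun n => ?_⟩
  refine tendsto_nhds_unique ((hlim n).comp (tendsto_add_atTop_nat 1))
    (((hlim (n - 1)).const_mul (w n)).congr fun k => ?_)
  rw [Function.comp_apply, Finset.prod_range_succ', mul_comm]
  simp only [Nat.cast_zero, sub_zero, Nat.cast_add, Nat.cast_one]
  congr 1
  refine Finset.prod_congr rfl fun i _ => ?_
  rw [sub_sub, add_comm]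

theorem exists_isCyclicVector_bilateralShift_of_not_tendsto {k₀ : ℕ} {lam : ℤ ⊕ Fin k₀ → ℝ}
    (hlam : ∀ v, 0 < lam v)
    {S : lp (fun _ : ℤ ⊕ Fin k₀ => ℂ) 2 →L[ℂ] lp (fun _ : ℤ ⊕ Fin k₀ => ℂ) 2}
    (hS : ∀ x v, S x v = lam v * x (treeParent k₀ v))
    {W : lp (fun _ : ℤ => ℂ) 2 →L[ℂ] lp (fun _ : ℤ => ℂ) 2}
    (hW : ∀ y n, W y n = lam (Sum.inl n) * y (n - 1)) (h1 : ‖S‖ ≤ 1)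
    (hC : ¬ ∀ x : lp (fun _ : ℤ ⊕ Fin k₀ => ℂ) 2,
      Tendsto (fun n : ℕ => ‖(S.adjoint ^ n) x‖) atTop (𝓝 0)) :
    ∃ g, IsCyclicVector W g := by
  obtain ⟨x, hlim, hx0, hx1, hx⟩ := exists_tendsto_prod_weight (w := fun n => lam (Sum.inl n))
    (fun n => hlam _) fun n => weight_le_one_of_norm_le_one hS h1 _
  have hne : ∃ m, x m ≠ 0 := by
    by_contra! h
    refine hC (tendsto_norm_pow_apply_of_single (by rwa [LinearIsometryEquiv.norm_map]) ?_)
    have hinl : ∀ n : ℤ, Tendsto (fun k : ℕ => ‖(S.adjoint ^ k)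
        (lp.single 2 (Sum.inl n) (1 : ℂ) : lp (fun _ : ℤ ⊕ Fin k₀ => ℂ) 2)‖) atTop (𝓝 0) := by
      intro n
      have := (hlim n).norm
      rw [h, norm_zero] at this
      refine this.congr fun k => ?_
      rw [adjoint_treeShift_pow_single_inl hS, norm_smul, lp.norm_single (by norm_num), norm_one,
        mul_one, Complex.norm_real]
    have hstep : ∀ v, Tendsto (fun k : ℕ => ‖(S.adjoint ^ k)
        (lp.single 2 (treeParent k₀ v) (1 : ℂ))‖) atTop (𝓝 0) →
        Tendsto (fun k : ℕ => ‖(S.adjoint ^ k) (lp.single 2 v (1 : ℂ))‖) atTop (𝓝 0) := by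
      intro v hv
      refine (tendsto_add_atTop_iff_nat 1).1 ?_
      have := hv.const_mul ‖(lam v : ℂ)‖
      rw [mul_zero] at this
      refine this.congr fun k => ?_
      rw [← norm_smul, ← map_smul, ← adjoint_treeShift_single hS, pow_succ]
      rfl
    rintro (n | ⟨j, hj⟩)
    · exact hinl n
    · induction j with
      | zero => exact hstep _ (hinl 0)
      | succ j ih => exact hstep _ (ih (by omega))
  obtain ⟨m, hm⟩ := hne
  have hpos : ∀ n, x n ≠ 0 := by
    intro n
    induction n using Int.inductionOn' (b := m) with
    | zero => exact hm
    | succ k _ ih =>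
      rw [hx, add_sub_cancel_right]
      exact mul_ne_zero (hlam _).ne' ih
    | pred k _ ih =>
      rw [hx] at ih
      exact right_ne_zero_of_mul ih
  exact exists_isCyclicVector_of_diagonal hW (fun n => (hx0 n).lt_of_ne' (hpos n)) hx1 hx

/-- For the rootless directed tree with `Br(𝒯) = 1` and unique leaf `k₀'`, a bounded weighted
shift `S_λ` on `𝒯` with strictly positive weights is cyclic if and only if the weighted
bilateral shift `W` with weights `{λ_n}_{n ∈ ℤ}` is cyclic.  In particular, if `S_λ` is a
contraction not of class `C_{·0}`, then `S_λ` is cyclic. -/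
theorem stmt_15 (k₀ : ℕ) (hk : 1 ≤ k₀)
    (lam : ℤ ⊕ Fin k₀ → ℝ) (hlam : ∀ v, 0 < lam v)
    (S : lp (fun _ : ℤ ⊕ Fin k₀ => ℂ) 2 →L[ℂ] lp (fun _ : ℤ ⊕ Fin k₀ => ℂ) 2)
    (hS : ∀ u v : ℤ ⊕ Fin k₀, (S (lp.single 2 u (1 : ℂ))) v =
      Set.indicator {w | treeE k₀ u w} (fun w => (lam w : ℂ)) v)
    (W : lp (fun _ : ℤ => ℂ) 2 →L[ℂ] lp (fun _ : ℤ => ℂ) 2)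
    (hW : ∀ n : ℤ, W (lp.single 2 n (1 : ℂ)) =
      ((lam (Sum.inl (n + 1)) : ℝ) : ℂ) • lp.single 2 (n + 1) (1 : ℂ)) :
    ((∃ f, IsCyclicVector S f) ↔ (∃ g, IsCyclicVector W g)) ∧
    ((‖S‖ ≤ 1 ∧ ¬ ∀ x : lp (fun _ : ℤ ⊕ Fin k₀ => ℂ) 2,
        Tendsto (fun n : ℕ => ‖((ContinuousLinearMap.adjoint S) ^ n) x‖) atTop (𝓝 0)) →
      ∃ f, IsCyclicVector S f) := by
  have hS' := treeShift_apply hS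
  have hiff := exists_isCyclicVector_treeShift_iff hk hlam hS' hW
  refine ⟨hiff, fun ⟨h1, hC⟩ => hiff.2 ?_⟩
  exact exists_isCyclicVector_bilateralShift_of_not_tendsto hlam hS'
    (bilateralShift_apply (w := fun n => lam (Sum.inl n)) hW) h1 hC
end

section
/- Let S be the simple bilateral shift on ℓ²(ℤ) (S e_n = e_{n+1} for all n ∈ ℤ) and S⁺ the simple unilateral shift on ℓ²(ℤ₊) (S⁺ e_k = e_{k+1} for all k ∈ ℤ₊). Then the orthogonal direct sum S ⊕ S⁺ acting on ℓ²(ℤ) ⊕ ℓ²(ℤ₊) has no cyclic vectors. -/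
open Filter Topology

/-- An operator on `ℓ²(ι)` that maps basis vectors to basis vectors along an injection `σ` transports
coordinates along `σ`. -/
theorem lp_apply_of_map_single {ι : Type*} [DecidableEq ι] {σ : ι → ι}
    (hσ : Function.Injective σ)
    {T : lp (fun _ : ι => ℂ) 2 →L[ℂ] lp (fun _ : ι => ℂ) 2}
    (hT : ∀ i, T (lp.single 2 i (1 : ℂ)) = lp.single 2 (σ i) (1 : ℂ))
    (x : lp (fun _ : ι => ℂ) 2) (i : ι) : T x (σ i) = x i := by
  have h : (lp.evalCLM ℂ (fun _ : ι => ℂ) 2 (σ i)).comp T =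
      lp.evalCLM ℂ (fun _ : ι => ℂ) 2 i := by
    refine lp.ext_continuousLinearMap (by simp) fun j => ?_
    ext
    change T (lp.single 2 j (1 : ℂ)) (σ i) = (lp.single 2 j (1 : ℂ) : lp (fun _ : ι => ℂ) 2) i
    simp [hT, lp.single_apply, Pi.single_apply, hσ.eq_iff]
  exact congrArg (· x) h

theorem lp_apply_eq_zero_of_map_single {ι : Type*} [DecidableEq ι] {σ : ι → ι}
    {T : lp (fun _ : ι => ℂ) 2 →L[ℂ] lp (fun _ : ι => ℂ) 2}
    (hT : ∀ i, T (lp.single 2 i (1 : ℂ)) = lp.single 2 (σ i) (1 : ℂ))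
    (x : lp (fun _ : ι => ℂ) 2) {j : ι} (hj : j ∉ Set.range σ) : T x j = 0 := by
  have h : (lp.evalCLM ℂ (fun _ : ι => ℂ) 2 j).comp T = 0 := by
    refine lp.ext_continuousLinearMap (by simp) fun i => ?_
    ext
    change T (lp.single 2 i (1 : ℂ)) j = 0
    rw [hT, lp.single_apply, Pi.single_apply, if_neg]
    rintro rfl
    exact hj ⟨i, rfl⟩
  exact congrArg (· x) h

/-- If `f` is cyclic for `T`, only the zero vector is orthogonal to the orbit of `f`. -/
theorem IsCyclicVector.eq_zero_of_forall_inner_eq_zero {H : Type*} [NormedAddCommGroup H]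
    [InnerProductSpace ℂ H] [CompleteSpace H] {T : H →L[ℂ] H} {f w : H}
    (hf : IsCyclicVector T f) (hw : ∀ n : ℕ, inner ℂ w ((T ^ n) f) = 0) : w = 0 := by
  rw [IsCyclicVector, Submodule.topologicalClosure_eq_top_iff, Submodule.eq_bot_iff] at hf
  refine hf w ((Submodule.mem_orthogonal' _ _).2 fun u hu => ?_)
  induction hu using Submodule.span_induction with
  | mem x hx =>
    obtain ⟨n, rfl⟩ := hx
    exact hw n
  | zero => simp
  | add x y _ _ hx hy => rw [inner_add_right, hx, hy, add_zero]
  | smul a x _ hx => rw [inner_smul_right, hx, mul_zero]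

/-- The coordinates of the vector orthogonal to the orbit of `f` under `S ⊕ S⁺`. -/
noncomputable def shiftOrbitAnnihilator (f : ℤ ⊕ ℕ → ℂ) : ℤ ⊕ ℕ → ℂ :=
  Sum.elim (fun m => if m ≤ 0 then star (f (Sum.inr (-m).toNat)) else 0)
    (fun k => -star (f (Sum.inl (-k))))

theorem injective_neg_natCast : Function.Injective fun j : ℕ => -(j : ℤ) :=
  fun a b h => by simpa using h

theorem shiftOrbitAnnihilator_inl_neg (f : ℤ ⊕ ℕ → ℂ) (j : ℕ) :
    shiftOrbitAnnihilator f (Sum.inl (-j)) = star (f (Sum.inr j)) := by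
  simp [shiftOrbitAnnihilator]

theorem shiftOrbitAnnihilator_inl_eq_zero (f : ℤ ⊕ ℕ → ℂ) {m : ℤ}
    (hm : m ∉ Set.range fun j : ℕ => -(j : ℤ)) :
    shiftOrbitAnnihilator f (Sum.inl m) = 0 := by
  have : ¬ m ≤ 0 := fun h => hm ⟨(-m).toNat, by simp only; lia⟩
  simp [shiftOrbitAnnihilator, this]

theorem memℓp_shiftOrbitAnnihilator (f : lp (fun _ : ℤ ⊕ ℕ => ℂ) 2) :
    Memℓp (shiftOrbitAnnihilator f) 2 := by
  have hf : Summable fun i => ‖f i‖ ^ (2 : ENNReal).toReal :=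
    (memℓp_gen_iff (by simp)).1 (lp.memℓp f)
  refine memℓp_gen (Summable.sum _ ?_ ?_)
  · refine (injective_neg_natCast.summable_iff fun m hm => ?_).1 ?_
    · simp [shiftOrbitAnnihilator_inl_eq_zero _ hm]
    · refine (hf.comp_injective Sum.inr_injective).congr fun j => ?_
      simp only [Function.comp_apply, shiftOrbitAnnihilator_inl_neg, norm_star]
  · refine (hf.comp_injective (Sum.inl_injective.comp injective_neg_natCast)).congr fun j => ?_
    simp [shiftOrbitAnnihilator]

/-- The orthogonal direct sum `S ⊕ S⁺` of the simple bilateral shift on `ℓ²(ℤ)` and the simple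
unilateral shift on `ℓ²(ℤ₊)`, realized as an operator on `ℓ²(ℤ ⊕ ℤ₊)`, has no cyclic
vectors. -/
theorem stmt_16
    (T : lp (fun _ : ℤ ⊕ ℕ => ℂ) 2 →L[ℂ] lp (fun _ : ℤ ⊕ ℕ => ℂ) 2)
    (hTbil : ∀ n : ℤ, T (lp.single 2 (Sum.inl n) (1 : ℂ)) =
      lp.single 2 (Sum.inl (n + 1)) (1 : ℂ))
    (hTuni : ∀ k : ℕ, T (lp.single 2 (Sum.inr k) (1 : ℂ)) =
      lp.single 2 (Sum.inr (k + 1)) (1 : ℂ)) :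
    ¬ ∃ f, IsCyclicVector T f := by
  rintro ⟨f, hf⟩
  have hpow (n : ℕ) (i : ℤ ⊕ ℕ) : (T ^ n) (lp.single 2 i (1 : ℂ)) =
      lp.single 2 (Sum.map (· + (n : ℤ)) (· + n) i) (1 : ℂ) := by
    induction n with
    | zero => rcases i with m | k <;> simp
    | succ n ih =>
      rw [pow_succ', mul_apply_eq_comp, ih]
      rcases i with m | k
      · simp [hTbil, add_assoc]
      · simp [hTuni, add_assoc]
  have hinj (n : ℕ) : Function.Injective (Sum.map (· + (n : ℤ)) (· + n)) :=
    (add_left_injective (n : ℤ)).sumMap (add_left_injective n)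
  have hinl (n : ℕ) (m : ℤ) : (T ^ n) f (Sum.inl (m + n)) = f (Sum.inl m) :=
    lp_apply_of_map_single (hinj n) (hpow n) f (Sum.inl m)
  have hinr (n k : ℕ) : (T ^ n) f (Sum.inr (k + n)) = f (Sum.inr k) :=
    lp_apply_of_map_single (hinj n) (hpow n) f (Sum.inr k)
  have hinr_zero (n k : ℕ) (hk : k < n) : (T ^ n) f (Sum.inr k) = 0 := by
    refine lp_apply_eq_zero_of_map_single (hpow n) f ?_
    rintro ⟨m | l, h⟩
    · simp at h
    · simp at h
      lia
  let w : lp (fun _ : ℤ ⊕ ℕ => ℂ) 2 := ⟨_, memℓp_shiftOrbitAnnihilator f⟩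
  have hw_apply (i : ℤ ⊕ ℕ) : w i = shiftOrbitAnnihilator f i := rfl
  have hw_zero : w = 0 := by
    refine hf.eq_zero_of_forall_inner_eq_zero fun n => ?_
    have hsum := lp.summable_inner (𝕜 := ℂ) w ((T ^ n) f)
    obtain ⟨c, hc⟩ := hsum.comp_injective (Sum.inl_injective.comp injective_neg_natCast)
    have hl : HasSum ((fun i => inner ℂ (w i : ℂ) ((T ^ n) f i : ℂ)) ∘ Sum.inl) c := by
      refine (injective_neg_natCast.hasSum_iff fun m hm => ?_).1 hc
      simp [hw_apply, shiftOrbitAnnihilator_inl_eq_zero _ hm]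
    have hr : HasSum ((fun i => inner ℂ (w i : ℂ) ((T ^ n) f i : ℂ)) ∘ Sum.inr) (-c) := by
      refine ((add_left_injective n).hasSum_iff fun k hk => ?_).1 ?_
      · have hk : k < n := by
          by_contra! h
          exact hk ⟨k - n, by simp only; lia⟩
        rw [Function.comp_apply, hinr_zero n k hk, inner_zero_right]
      · refine hc.neg.congr_fun fun j => ?_
        have h := hinl n (-(j + n : ℕ))
        rw [show -((j + n : ℕ) : ℤ) + n = -j by push_cast; ring] at h
        simp only [Function.comp_apply, hw_apply, shiftOrbitAnnihilator_inl_neg, h, hinr]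
        simp [shiftOrbitAnnihilator, mul_comm]
    exact (lp.hasSum_inner (𝕜 := ℂ) w ((T ^ n) f)).unique (by simpa using hl.sum hr)
  have hf_inr (k : ℕ) : f (Sum.inr k) = 0 := by
    have h := shiftOrbitAnnihilator_inl_neg f k
    rw [← hw_apply, hw_zero] at h
    simpa using h.symm
  have hsingle : lp.single 2 (Sum.inr 0) (1 : ℂ) = (0 : lp (fun _ : ℤ ⊕ ℕ => ℂ) 2) := by
    refine hf.eq_zero_of_forall_inner_eq_zero fun n => ?_
    rw [lp.inner_single_left]
    rcases n with _ | n
    · simp [hf_inr]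
    · rw [hinr_zero _ _ n.succ_pos, inner_zero_right]
  have h := congrArg (fun x : lp (fun _ : ℤ ⊕ ℕ => ℂ) 2 => x (Sum.inr 0)) hsingle
  simp at h
end
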